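/- Let H be a connected planar graph and let ε > 0 be a real number. Suppose g : ℕ → ℕ is a function with g(n) = Ω(n^{1+ε}) (i.e. there exist c > 0 and N such that g(n) ≥ c · n^{1+ε} for all n ≥ N) such that for every graph G and every integer k > 0, tw(G) ≥ g(k) implies that G contains k pairwise disjoint models of H. Then H has the Erdős–Pósa property with gap O(g): there is a constant C > 0 such that for every integer k ≥ 1 and every graph G with pack_H(G) ≤ k, we have cover_H(G) ≤ C · g(k). -/

import Mathlib

open SimpleGraph

/-- A minor model of `H` in `G`: pairwise disjoint branch sets `B v ⊆ V(G)`, each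
inducing a connected (hence nonempty) subgraph of `G`, such that for every edge
`{u,v}` of `H` there is an edge of `G` between `B u` and `B v`. -/
def IsMinorModel {β α : Type*} (H : SimpleGraph β) (G : SimpleGraph α)
    (B : β → Set α) : Prop :=
  (∀ u, (G.induce (B u)).Connected) ∧
  (Pairwise fun u v => Disjoint (B u) (B v)) ∧
  (∀ u v, H.Adj u v → ∃ a ∈ B u, ∃ b ∈ B v, G.Adj a b)

/-- `H` is a minor of `G`. -/
def IsMinor {β α : Type*} (H : SimpleGraph β) (G : SimpleGraph α) : Prop :=
  ∃ B : β → Set α, IsMinorModel H G B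

/-- `G` contains `k` models of `H` whose vertex sets are pairwise disjoint
(equivalently, the disjoint union of `k` copies of `H` is a minor of `G`). -/
def HasDisjointModels {β α : Type*} (H : SimpleGraph β) (G : SimpleGraph α) (k : ℕ) : Prop :=
  ∃ M : Fin k → β → Set α, (∀ i, IsMinorModel H G (M i)) ∧
    Pairwise fun i j => Disjoint (⋃ u, M i u) (⋃ u, M j u)

/-- `pack_H(G)`: the maximum number of pairwise disjoint models of `H` in `G`. -/
noncomputable def packNumber {β α : Type*} (H : SimpleGraph β) (G : SimpleGraph α) : ℕ :=
  sSup {k | HasDisjointModels H G k}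

/-- `S` meets every model of `H` in `G`. -/
def IsHittingSet {β α : Type*} (H : SimpleGraph β) (G : SimpleGraph α) (S : Set α) : Prop :=
  ∀ B : β → Set α, IsMinorModel H G B → ∃ a ∈ S, ∃ u, a ∈ B u

/-- `cover_H(G)`: the minimum size of a set of vertices meeting every model of `H` in `G`. -/
noncomputable def coverNumber {β α : Type*} (H : SimpleGraph β) (G : SimpleGraph α) : ℕ :=
  sInf {n | ∃ S : Set α, IsHittingSet H G S ∧ S.ncard = n}

/-- A tree/path decomposition of `G` with underlying graph `T` and bags `X`. -/
def IsTreeDecomp {α ι : Type*} (G : SimpleGraph α) (T : SimpleGraph ι) (X : ι → Set α) : Prop :=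
  (∀ v, ∃ t, v ∈ X t) ∧
  (∀ u v, G.Adj u v → ∃ t, u ∈ X t ∧ v ∈ X t) ∧
  (∀ v, (T.induce {t | v ∈ X t}).Connected)

/-- The treewidth of `G`: the minimum width of a tree decomposition of `G`. -/
noncomputable def treewidth {α : Type*} (G : SimpleGraph α) : ℕ :=
  sInf {w | ∃ (ι : Type) (T : SimpleGraph ι) (X : ι → Set α),
    T.IsTree ∧ IsTreeDecomp G T X ∧ ∀ t, (X t).ncard ≤ w + 1}

/-- The pathwidth of `G`: the minimum width of a tree decomposition whose
underlying tree is a path. -/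
noncomputable def pathwidth {α : Type*} (G : SimpleGraph α) : ℕ :=
  sInf {w | ∃ (n : ℕ) (X : Fin (n+1) → Set α),
    IsTreeDecomp G (pathGraph (n+1)) X ∧ ∀ t, (X t).ncard ≤ w + 1}

/-- The degeneracy of `G`: the maximum over all (nonempty) subgraphs of `G`
of the minimum degree. -/
noncomputable def degeneracy {α : Type*} (G : SimpleGraph α) : ℕ :=
  sSup {d | ∃ G' : G.Subgraph, G'.verts.Nonempty ∧ ∀ v ∈ G'.verts, d ≤ (G'.neighborSet v).ncard}

/-- The contraction degeneracy of `G`: the maximum over all (nonempty) minors of `G`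
of the minimum degree. -/
noncomputable def contractionDegeneracy {α : Type*} (G : SimpleGraph α) : ℕ :=
  sSup {d | ∃ (n : ℕ) (H : SimpleGraph (Fin n)), 0 < n ∧ IsMinor H G ∧
    ∀ v, d ≤ (H.neighborSet v).ncard}


/-- `X` and `Y` are externally `q`-connected within the vertex set `W` of `G`:
for all disjoint `X' ⊆ X`, `Y' ⊆ Y` with `|X'| = |Y'| ≤ q` there are `|X'|`
pairwise disjoint `X'`–`Y'` paths (inside `W`) having no internal vertices and
no edges in `G[X ∪ Y]`. -/
def ExternallyConnectedIn {α : Type*} (G : SimpleGraph α) (W X Y : Set α) (q : ℕ) : Prop :=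
  ∀ X' Y' : Finset α, ↑X' ⊆ X → ↑Y' ⊆ Y → Disjoint (X' : Set α) (Y' : Set α) →
    X'.card = Y'.card → X'.card ≤ q →
    ∃ p : (x : X') → Σ y : Y', G.Walk x.1 y.1,
      (∀ x, (p x).2.IsPath) ∧
      (∀ x, ∀ v ∈ (p x).2.support, v ∈ W) ∧
      (Pairwise fun x₁ x₂ => ∀ v, v ∈ (p x₁).2.support → v ∉ (p x₂).2.support) ∧
      (∀ x, ∀ v ∈ (p x).2.support.tail.dropLast, v ∉ X ∪ Y) ∧
      (∀ x, ∀ u v : α, s(u, v) ∈ (p x).2.edges → ¬(u ∈ X ∪ Y ∧ v ∈ X ∪ Y))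

/-- `(A, B)` is a `q`-mesh of order `s` in `G`. -/
def IsMesh {α : Type*} (G : SimpleGraph α) (A B : Set α) (q s : ℕ) : Prop :=
  A ∪ B = Set.univ ∧
  ∃ T : G.Subgraph, T.verts ⊆ A ∧ T.coe.IsTree ∧
    (∀ v ∈ T.verts, (T.neighborSet v).ncard ≤ 3) ∧
    A ∩ B ⊆ T.verts ∧
    (∀ v ∈ A ∩ B, (T.neighborSet v).ncard ≤ 2) ∧
    (∃ v ∈ A ∩ B, (T.neighborSet v).ncard = 1) ∧
    (A ∩ B).ncard = s ∧
    ExternallyConnectedIn G B (A ∩ B) (A ∩ B) q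

/-- The graph `Ξ_r`, with vertices `x_i = (0,i)`, `y_i = (1,i)`, `z_i = (2,i)`. -/
def Xi (r : ℕ) : SimpleGraph (Fin 3 × Fin r) :=
  SimpleGraph.fromRel (fun a b =>
    (a.1 = 0 ∧ b.1 = 0 ∧ (b.2 : ℕ) = (a.2 : ℕ) + 1) ∨
    (a.1 = 2 ∧ b.1 = 2 ∧ (b.2 : ℕ) = (a.2 : ℕ) + 1) ∨
    (a.1 = 1 ∧ a.2 = b.2 ∧ (b.1 = 0 ∨ b.1 = 2)))

/-- The underlying simple bipartite graph of the bipartite multigraph with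
parts `α`, `β` and multiplicity function `m`. -/
def bipMulti {α β : Type*} (m : α → β → ℕ) : SimpleGraph (α ⊕ β) :=
  SimpleGraph.fromRel (fun x y => match x, y with
    | Sum.inl v, Sum.inr u => 1 ≤ m v u
    | _, _ => False)


/-- A nonempty vertex set that is contained in every set it meets and in which it is closed under
adjacency; equivalently, a set inducing a connected subgraph. -/
def ConnSet {α : Type*} (G : SimpleGraph α) (A : Set α) : Prop :=
  A.Nonempty ∧ ∀ Q : Set α, (A ∩ Q).Nonempty →
    (∀ u ∈ A, u ∈ Q → ∀ v ∈ A, G.Adj u v → v ∈ Q) → A ⊆ Q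

theorem connSet_iff_induce_connected {α : Type*} (G : SimpleGraph α) (A : Set α) :
    ConnSet G A ↔ (G.induce A).Connected := by
  constructor
  · rintro ⟨⟨a, ha⟩, h⟩
    refine (connected_iff_exists_forall_reachable _).2 ⟨⟨a, ha⟩, ?_⟩
    have := h {x | ∃ hx : x ∈ A, (G.induce A).Reachable ⟨a, ha⟩ ⟨x, hx⟩}
      ⟨a, ha, ha, Reachable.refl _⟩ ?_
    · rintro ⟨w, hw⟩
      exact (this hw).2
    · rintro u - ⟨hu, hr⟩ v hv huv
      exact ⟨hv, hr.trans (Adj.reachable (by simpa using huv))⟩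
  · intro hc
    obtain ⟨⟨a, ha⟩⟩ := hc.nonempty
    refine ⟨⟨a, ha⟩, ?_⟩
    rintro Q ⟨q, hqA, hqQ⟩ hcl x hx
    obtain ⟨w⟩ := hc.preconnected ⟨q, hqA⟩ ⟨x, hx⟩
    suffices H : ∀ (u v : A) (_ : (G.induce A).Walk u v), u.1 ∈ Q → v.1 ∈ Q from H _ _ w hqQ
    intro u v w
    induction w with
    | nil => exact id
    | cons hadj _ ih => exact fun hu => ih (hcl _ (Subtype.prop _) hu _ (Subtype.prop _) hadj)

namespace ConnSet
variable {α : Type*} {G : SimpleGraph α}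

theorem nonempty {A : Set α} (h : ConnSet G A) : A.Nonempty := h.1

theorem subset_of_closed {A Q : Set α} (h : ConnSet G A) {x : α} (hx : x ∈ A) (hxQ : x ∈ Q)
    (hcl : ∀ u ∈ A, u ∈ Q → ∀ v ∈ A, G.Adj u v → v ∈ Q) : A ⊆ Q :=
  h.2 Q ⟨x, hx, hxQ⟩ hcl

theorem singleton (G : SimpleGraph α) (a : α) : ConnSet G {a} := by
  refine ⟨⟨a, rfl⟩, ?_⟩
  rintro Q ⟨q, rfl, hq⟩ - x rfl
  exact hq

theorem union {A B : Set α} (hA : ConnSet G A) (hB : ConnSet G B) (h : (A ∩ B).Nonempty) :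
    ConnSet G (A ∪ B) := by
  obtain ⟨c, hcA, hcB⟩ := h
  refine ⟨⟨c, Or.inl hcA⟩, ?_⟩
  rintro Q ⟨q, hq, hqQ⟩ hcl
  have hA' : ∀ x ∈ A, x ∈ Q → A ⊆ Q := fun x hx hxQ => hA.subset_of_closed hx hxQ
    fun u hu huQ v hv => hcl u (Or.inl hu) huQ v (Or.inl hv)
  have hB' : ∀ x ∈ B, x ∈ Q → B ⊆ Q := fun x hx hxQ => hB.subset_of_closed hx hxQ
    fun u hu huQ v hv => hcl u (Or.inr hu) huQ v (Or.inr hv)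
  rcases hq with hq | hq
  · have := hA' q hq hqQ
    exact Set.union_subset this (hB' c hcB (this hcA))
  · have := hB' q hq hqQ
    exact Set.union_subset (hA' c hcA (this hcB)) this

theorem pair {a b : α} (h : G.Adj a b) : ConnSet G {a, b} := by
  refine ⟨⟨a, by simp⟩, ?_⟩
  rintro Q ⟨q, hq, hqQ⟩ hcl
  have h1 : a ∈ Q ↔ b ∈ Q :=
    ⟨fun ha => hcl a (by simp) ha b (by simp) h, fun hb => hcl b (by simp) hb a (by simp) h.symm⟩
  rintro x (rfl | rfl) <;> rcases hq with rfl | rfl <;> simp_all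

theorem union_adj {A B : Set α} (hA : ConnSet G A) (hB : ConnSet G B) {a b : α} (ha : a ∈ A)
    (hb : b ∈ B) (h : G.Adj a b) : ConnSet G (A ∪ B) := by
  have h1 := (hA.union (pair h) ⟨a, ha, by simp⟩).union hB ⟨b, by simp, hb⟩
  convert h1 using 1
  ext x
  simp only [Set.mem_union, Set.mem_insert_iff, Set.mem_singleton_iff]
  constructor
  · tauto
  · rintro ((h | rfl | rfl) | h) <;> tauto

theorem insert_adj {A : Set α} (hA : ConnSet G A) {a b : α} (ha : a ∈ A) (h : G.Adj a b) :
    ConnSet G (insert b A) := by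
  have := hA.union_adj (singleton G b) ha rfl h
  rwa [Set.union_singleton] at this

/-- A union of connected sets all meeting a connected set, together with that set. -/
theorem union_iUnion {ι : Type*} {A : Set α} {B : ι → Set α} (hA : ConnSet G A)
    (h : ∀ i, ConnSet G (A ∪ B i)) : ConnSet G (A ∪ ⋃ i, B i) := by
  obtain ⟨a, ha⟩ := hA.nonempty
  refine ⟨⟨a, Or.inl ha⟩, ?_⟩
  rintro Q ⟨q, hq, hqQ⟩ hcl
  have key : ∀ i, ∀ x ∈ A ∪ B i, x ∈ Q → A ∪ B i ⊆ Q := fun i x hx hxQ =>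
    (h i).subset_of_closed hx hxQ fun u hu huQ v hv =>
      hcl u (Set.union_subset_union_right _ (Set.subset_iUnion B i) hu) huQ v
        (Set.union_subset_union_right _ (Set.subset_iUnion B i) hv)
  have haQ : a ∈ Q := by
    rcases hq with hq | hq
    · exact hA.subset_of_closed hq hqQ
        (fun u hu huQ v hv => hcl u (Or.inl hu) huQ v (Or.inl hv)) ha
    · obtain ⟨i, hi⟩ := Set.mem_iUnion.1 hq
      exact key i q (Or.inr hi) hqQ (Or.inl ha)
  rintro x (hx | hx)
  · exact hA.subset_of_closed ha haQ
      (fun u hu huQ v hv => hcl u (Or.inl hu) huQ v (Or.inl hv)) hx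
  · obtain ⟨i, hi⟩ := Set.mem_iUnion.1 hx
    exact key i a (Or.inl ha) haQ (Or.inr hi)

theorem image_iff {W : Set α} {B : Set W} :
    ConnSet G (Subtype.val '' B) ↔ ConnSet (G.induce W) B := by
  constructor
  · rintro ⟨h1, h2⟩
    refine ⟨by simpa using h1, ?_⟩
    rintro Q ⟨q, hq, hqQ⟩ hcl x hx
    have := h2 (Subtype.val '' Q) ⟨q.1, ⟨q, hq, rfl⟩, ⟨q, hqQ, rfl⟩⟩ ?_ ⟨x, hx, rfl⟩
    · simpa using this
    · rintro _ ⟨u, hu, rfl⟩ hu' _ ⟨v, hv, rfl⟩ huv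
      exact ⟨v, hcl u hu (by simpa using hu') v hv huv, rfl⟩
  · rintro ⟨h1, h2⟩
    refine ⟨h1.image _, ?_⟩
    rintro Q ⟨_, ⟨q, hq, rfl⟩, hqQ⟩ hcl _ ⟨x, hx, rfl⟩
    refine h2 (Subtype.val ⁻¹' Q) ⟨q, hq, hqQ⟩ ?_ hx
    intro u hu huQ v hv huv
    exact hcl u.1 ⟨u, hu, rfl⟩ huQ v.1 ⟨v, hv, rfl⟩ huv

theorem preimage {W A : Set α} (hA : ConnSet G A) (h : A ⊆ W) :
    ConnSet (G.induce W) (Subtype.val ⁻¹' A) := by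
  rw [← image_iff, Subtype.image_preimage_coe, Set.inter_eq_right.2 h]
  exact hA

end ConnSet

/-- The vertices of the component of `v` in the subgraph induced by `D`. -/
def compIn {α : Type*} (G : SimpleGraph α) (D : Set α) (v : α) : Set α :=
  {u | ∃ c ⊆ D, ConnSet G c ∧ v ∈ c ∧ u ∈ c}

section compIn
variable {α : Type*} {G : SimpleGraph α} {D : Set α} {v : α}

theorem compIn_subset : compIn G D v ⊆ D := fun _ ⟨_, hc, _, _, hu⟩ => hc hu

theorem mem_compIn_self (hv : v ∈ D) : v ∈ compIn G D v :=
  ⟨{v}, by simpa using hv, ConnSet.singleton G v, rfl, rfl⟩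

theorem connSet_compIn (hv : v ∈ D) : ConnSet G (compIn G D v) := by
  refine ⟨⟨v, mem_compIn_self hv⟩, ?_⟩
  rintro Q ⟨q, ⟨c, hcD, hc, hvc, hqc⟩, hqQ⟩ hcl
  have key : ∀ c ⊆ D, ConnSet G c → v ∈ c → ∀ x ∈ c, x ∈ Q → c ⊆ Q :=
    fun c hcD hc hvc x hx hxQ => hc.subset_of_closed hx hxQ fun u hu huQ w hw =>
      hcl u ⟨c, hcD, hc, hvc, hu⟩ huQ w ⟨c, hcD, hc, hvc, hw⟩
  have hvQ := key c hcD hc hvc q hqc hqQ hvc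
  rintro x ⟨c', hcD', hc', hvc', hx⟩
  exact key c' hcD' hc' hvc' v hvc' hvQ hx

theorem subset_compIn_of_mem {c : Set α} (hcD : c ⊆ D) (hc : ConnSet G c) {u : α} (hu : u ∈ c)
    (hu' : u ∈ compIn G D v) : c ⊆ compIn G D v := by
  obtain ⟨c', hcD', hc', hvc', huc'⟩ := hu'
  intro x hx
  exact ⟨c' ∪ c, Set.union_subset hcD' hcD, hc'.union hc ⟨u, huc', hu⟩, Or.inl hvc', Or.inr hx⟩

theorem mem_compIn_of_adj {u w : α} (hu : u ∈ compIn G D v) (hw : w ∈ D) (h : G.Adj u w) :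
    w ∈ compIn G D v := by
  have hu' := compIn_subset hu
  exact subset_compIn_of_mem (c := {u, w}) (by rintro x (rfl | rfl) <;> assumption)
    (ConnSet.pair h) (by simp) hu (by simp)

end compIn

section models
variable {α β : Type*} {H : SimpleGraph β} {G : SimpleGraph α}

theorem isMinorModel_iff {B : β → Set α} : IsMinorModel H G B ↔ (∀ u, ConnSet G (B u)) ∧
    (Pairwise fun u v => Disjoint (B u) (B v)) ∧
    (∀ u v, H.Adj u v → ∃ a ∈ B u, ∃ b ∈ B v, G.Adj a b) := by
  simp only [IsMinorModel, connSet_iff_induce_connected]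

theorem IsMinorModel.image_val {W : Set α} {B : β → Set W} (h : IsMinorModel H (G.induce W) B) :
    IsMinorModel H G (fun u => Subtype.val '' B u) := by
  rw [isMinorModel_iff] at h ⊢
  refine ⟨fun u => ConnSet.image_iff.2 (h.1 u), fun u v huv => ?_, fun u v huv => ?_⟩
  · exact (Set.disjoint_image_iff Subtype.val_injective).2 (h.2.1 huv)
  · obtain ⟨a, ha, b, hb, hab⟩ := h.2.2 u v huv
    exact ⟨a, ⟨a, ha, rfl⟩, b, ⟨b, hb, rfl⟩, hab⟩

theorem IsMinorModel.preimage_val {W : Set α} {B : β → Set α} (h : IsMinorModel H G B)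
    (hW : ∀ u, B u ⊆ W) : IsMinorModel H (G.induce W) (fun u => Subtype.val ⁻¹' B u) := by
  rw [isMinorModel_iff] at h ⊢
  refine ⟨fun u => (h.1 u).preimage (hW u), fun u v huv => (h.2.1 huv).preimage _,
    fun u v huv => ?_⟩
  obtain ⟨a, ha, b, hb, hab⟩ := h.2.2 u v huv
  exact ⟨⟨a, hW u ha⟩, ha, ⟨b, hW v hb⟩, hb, hab⟩

/-- The vertex set of a model of a connected graph is connected. -/
theorem IsMinorModel.connSet_iUnion (hH : H.Connected) {B : β → Set α}
    (h : IsMinorModel H G B) : ConnSet G (⋃ u, B u) := by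
  rw [isMinorModel_iff] at h
  obtain ⟨u₀⟩ := hH.nonempty
  obtain ⟨a, ha⟩ := (h.1 u₀).nonempty
  refine ⟨⟨a, Set.mem_iUnion.2 ⟨u₀, ha⟩⟩, ?_⟩
  rintro Q ⟨q, hq, hqQ⟩ hcl
  obtain ⟨u₁, hu₁⟩ := Set.mem_iUnion.1 hq
  have key : ∀ u, ∀ x ∈ B u, x ∈ Q → B u ⊆ Q := fun u x hx hxQ =>
    (h.1 u).subset_of_closed hx hxQ fun y hy hyQ z hz =>
      hcl y (Set.mem_iUnion.2 ⟨u, hy⟩) hyQ z (Set.mem_iUnion.2 ⟨u, hz⟩)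
  have step : ∀ u v, H.Adj u v → B u ⊆ Q → B v ⊆ Q := by
    intro u v huv hu
    obtain ⟨a, ha, b, hb, hab⟩ := h.2.2 u v huv
    exact key v b hb (hcl a (Set.mem_iUnion.2 ⟨u, ha⟩) (hu ha) b (Set.mem_iUnion.2 ⟨v, hb⟩) hab)
  have hall : ∀ u v (_ : H.Walk u v), B u ⊆ Q → B v ⊆ Q := by
    intro u v w
    induction w with
    | nil => exact id
    | cons hadj _ ih => exact fun hu => ih (step _ _ hadj hu)
  refine Set.iUnion_subset fun v => ?_
  obtain ⟨w⟩ := hH.preconnected u₁ v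
  exact hall _ _ w (key u₁ q hu₁ hqQ)

end models

theorem ConnSet.mono_graph {α : Type*} {G G' : SimpleGraph α} (h : G ≤ G') {A : Set α}
    (hA : ConnSet G A) : ConnSet G' A :=
  ⟨hA.1, fun Q hQ hcl => hA.2 Q hQ fun u hu huQ v hv huv => hcl u hu huQ v hv (h huv)⟩

section density
open Classical in
/-- The ordered pairs of adjacent vertices of `S`. -/
noncomputable def adjPairs {α : Type*} (G : SimpleGraph α) (S : Finset α) : Finset (α × α) :=
  (S ×ˢ S).filter fun p => G.Adj p.1 p.2

variable {α : Type*} {G : SimpleGraph α}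

theorem mem_adjPairs {S : Finset α} {p : α × α} :
    p ∈ adjPairs G S ↔ (p.1 ∈ S ∧ p.2 ∈ S) ∧ G.Adj p.1 p.2 := by
  simp [adjPairs]

open Classical in
theorem card_adjPairs_le_erase (S : Finset α) (v : α) :
    (adjPairs G S).card ≤
      (adjPairs G (S.erase v)).card + 2 * (S.filter fun u => G.Adj v u).card := by
  have : adjPairs G S ⊆ adjPairs G (S.erase v) ∪
      ((S.filter fun u => G.Adj v u).image (fun u => (v, u)) ∪
        (S.filter fun u => G.Adj v u).image (fun u => (u, v))) := by
    rintro ⟨a, b⟩ h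
    rw [mem_adjPairs] at h
    simp only [Finset.mem_union, mem_adjPairs, Finset.mem_erase, Finset.mem_image,
      Finset.mem_filter, Prod.mk.injEq]
    by_cases ha : a = v
    · right; left
      exact ⟨b, ⟨h.1.2, ha ▸ h.2⟩, ha.symm, rfl⟩
    · by_cases hb : b = v
      · right; right
        exact ⟨a, ⟨h.1.1, hb ▸ h.2.symm⟩, rfl, hb.symm⟩
      · left
        exact ⟨⟨⟨ha, h.1.1⟩, hb, h.1.2⟩, h.2⟩
  refine (Finset.card_le_card this).trans ((Finset.card_union_le _ _).trans ?_)
  refine Nat.add_le_add_left ((Finset.card_union_le _ _).trans ?_) _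
  have h1 := Finset.card_image_le (s := S.filter fun u => G.Adj v u) (f := fun u => (v, u))
  have h2 := Finset.card_image_le (s := S.filter fun u => G.Adj v u) (f := fun u => (u, v))
  omega

/-- A dense set contains a dense subset all of whose vertices have large degree in it. -/
theorem exists_minimal_dense {D : ℕ} (S : Finset α) (hS : S.Nonempty)
    (hD : D * S.card ≤ (adjPairs G S).card) (hD0 : 0 < D) : ∃ T ⊆ S, T.Nonempty ∧
      ∀ v ∈ T, open Classical in D < 2 * (T.filter fun u => G.Adj v u).card := by
  classical
  induction S using Finset.strongInduction with
  | H S ih =>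
    by_cases h : ∀ v ∈ S, D < 2 * (S.filter fun u => G.Adj v u).card
    · exact ⟨S, subset_rfl, hS, h⟩
    · push Not at h
      obtain ⟨v, hv, hle⟩ := h
      have h1 := card_adjPairs_le_erase (G := G) S v
      have h2 := Finset.card_erase_add_one hv
      have h3 : D * (S.erase v).card ≤ (adjPairs G (S.erase v)).card := by
        rw [← h2, mul_add] at hD; omega
      have h4 : (S.erase v).Nonempty := by
        rw [Finset.nonempty_iff_ne_empty]
        intro h0
        have hSv : S.card = 1 := by rw [← h2, h0]; rfl
        obtain ⟨a, rfl⟩ := Finset.card_eq_one.1 hSv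
        have : adjPairs G {a} = ∅ := by
          ext ⟨x, y⟩
          simp only [mem_adjPairs, Finset.mem_singleton, Finset.notMem_empty, iff_false]
          rintro ⟨⟨rfl, rfl⟩, h⟩
          exact h.ne rfl
        rw [this] at hD
        simp at hD
        omega
      obtain ⟨T, hT, hT'⟩ := ih _ (Finset.erase_ssubset hv) h4 h3
      exact ⟨T, hT.trans (Finset.erase_subset _ _), hT'⟩

open Classical in
/-- The vertices of `S` at distance less than `n` from `v` in the subgraph induced by `S`. -/
noncomputable def ballIn (G : SimpleGraph α) (S : Finset α) (v : α) : ℕ → Finset α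
  | 0 => ∅
  | n + 1 => S.filter fun x => x = v ∨ x ∈ ballIn G S v n ∨ ∃ y ∈ ballIn G S v n, G.Adj y x

section ballIn
variable {S : Finset α} {v : α}

theorem mem_ballIn_succ {n : ℕ} {x : α} : x ∈ ballIn G S v (n + 1) ↔
    x ∈ S ∧ (x = v ∨ x ∈ ballIn G S v n ∨ ∃ y ∈ ballIn G S v n, G.Adj y x) := by
  simp [ballIn]

theorem ballIn_subset (n : ℕ) : ballIn G S v n ⊆ S := by
  cases n with
  | zero => simp [ballIn]
  | succ n => exact fun x hx => (mem_ballIn_succ.1 hx).1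

theorem ballIn_subset_succ (n : ℕ) : ballIn G S v n ⊆ ballIn G S v (n + 1) :=
  fun _ hx => mem_ballIn_succ.2 ⟨ballIn_subset n hx, Or.inr (Or.inl hx)⟩

theorem ballIn_mono : Monotone (ballIn G S v) := monotone_nat_of_le_succ ballIn_subset_succ

theorem self_mem_ballIn (hv : v ∈ S) (n : ℕ) : v ∈ ballIn G S v (n + 1) :=
  mem_ballIn_succ.2 ⟨hv, Or.inl rfl⟩

theorem exists_connSet_of_mem_ballIn (n : ℕ) (x : α) (hx : x ∈ ballIn G S v n) :
    ∃ P : Finset α, P ⊆ ballIn G S v n ∧ ConnSet G (P : Set α) ∧ v ∈ P ∧ x ∈ P ∧ P.card ≤ n := by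
  classical
  induction n generalizing x with
  | zero => simp [ballIn] at hx
  | succ n ih =>
    obtain ⟨hxS, rfl | hx' | ⟨y, hy, hyx⟩⟩ := mem_ballIn_succ.1 hx
    · exact ⟨{x}, by simpa using hx, by simpa using ConnSet.singleton G x, by simp, by simp,
        by simp⟩
    · obtain ⟨P, h1, h2, h3, h4, h5⟩ := ih x hx'
      exact ⟨P, h1.trans (ballIn_subset_succ n), h2, h3, h4, h5.trans n.le_succ⟩
    · obtain ⟨P, h1, h2, h3, h4, h5⟩ := ih y hy
      refine ⟨insert x P, ?_, ?_, by simp [h3], by simp,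
        (Finset.card_insert_le _ _).trans (by omega)⟩
      · exact Finset.insert_subset hx (h1.trans (ballIn_subset_succ n))
      · rw [Finset.coe_insert]
        exact h2.insert_adj h4 hyx

theorem exists_ballIn_card_le (hv : v ∈ S) : ∃ r, 1 ≤ r ∧ r ≤ Nat.log 2 S.card + 1 ∧
    (ballIn G S v (r + 1)).card ≤ 2 * (ballIn G S v r).card := by
  by_contra! h
  have key : ∀ n, n ≤ Nat.log 2 S.card + 1 → 2 ^ n ≤ (ballIn G S v (n + 1)).card := by
    intro n
    induction n with
    | zero => exact fun _ => Finset.card_pos.2 ⟨v, self_mem_ballIn hv 0⟩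
    | succ n ih =>
      intro hn
      have h1 := ih (by omega)
      have h2 := h (n + 1) (by omega) hn
      rw [pow_succ]; omega
  have h1 := key _ le_rfl
  have h2 := Finset.card_le_card (ballIn_subset (G := G) (S := S) (v := v)
    (Nat.log 2 S.card + 1 + 1))
  have h3 := Nat.lt_pow_succ_log_self (b := 2) (by norm_num) S.card
  rw [Nat.succ_eq_add_one] at h3
  omega

end ballIn

/-- The edges of `G` meeting `L`. -/
def edgesMeeting (G : SimpleGraph α) (L : Finset α) : SimpleGraph α where
  Adj x y := G.Adj x y ∧ (x ∈ L ∨ y ∈ L)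
  symm := ⟨fun _ _ h => ⟨h.1.symm, h.2.symm⟩⟩
  loopless := ⟨fun _ h => h.1.ne rfl⟩

theorem edgesMeeting_le (L : Finset α) : edgesMeeting G L ≤ G := fun _ _ h => h.1

open Classical in
/-- If all degrees in `T` are large then two consecutive layers around a vertex are dense. -/
theorem exists_dense_layer {d : ℕ} {T : Finset α} {v : α} (hv : v ∈ T)
    (hdeg : ∀ v ∈ T, 8 * (d + 2) < 2 * (T.filter fun u => G.Adj v u).card) :
    ∃ i, 1 ≤ i ∧ i ≤ Nat.log 2 T.card + 1 ∧
      (d + 2) * (ballIn G T v (i + 2) \ ballIn G T v i).card <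
        (adjPairs (edgesMeeting G (ballIn G T v (i + 1) \ ballIn G T v i))
          (ballIn G T v (i + 2) \ ballIn G T v i)).card := by
  obtain ⟨r, hr1, hr2, hr3⟩ := exists_ballIn_card_le (G := G) hv
  set C := ballIn G T v with hC
  have hmono : Monotone C := ballIn_mono
  set E : ℕ → Finset (α × α) := fun i =>
    adjPairs (edgesMeeting G (C (i + 1) \ C i)) (C (i + 2) \ C i) with hE
  have hcover : ((C r) ×ˢ T).filter (fun p => G.Adj p.1 p.2) ⊆ (Finset.range r).biUnion E := by
    rintro ⟨x, y⟩ hxy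
    simp only [Finset.mem_filter, Finset.mem_product] at hxy
    obtain ⟨⟨hx, hy⟩, hadj⟩ := hxy
    have hex : ∃ n, x ∈ C n ∨ y ∈ C n := ⟨r, Or.inl hx⟩
    have hn := Nat.find_spec hex
    have hmin : ∀ m < Nat.find hex, _ := fun m hm => Nat.find_min hex hm
    have hle : Nat.find hex ≤ r := Nat.find_le (Or.inl hx)
    generalize Nat.find hex = n at *
    cases n with
    | zero => simp [hC, ballIn] at hn
    | succ i =>
      have hi := hmin i (by omega)
      push Not at hi
      have hxT := ballIn_subset r hx
      have h2 : x ∈ C (i + 2) ∧ y ∈ C (i + 2) := by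
        rcases hn with hn | hn
        · exact ⟨ballIn_subset_succ _ hn, mem_ballIn_succ.2 ⟨hy, Or.inr (Or.inr ⟨x, hn, hadj⟩)⟩⟩
        · exact ⟨mem_ballIn_succ.2 ⟨hxT, Or.inr (Or.inr ⟨y, hn, hadj.symm⟩)⟩,
            ballIn_subset_succ _ hn⟩
      refine Finset.mem_biUnion.2 ⟨i, Finset.mem_range.2 (by omega), ?_⟩
      simp only [hE, mem_adjPairs, Finset.mem_sdiff]
      refine ⟨⟨⟨h2.1, hi.1⟩, h2.2, hi.2⟩, hadj, ?_⟩
      simp only [Finset.mem_sdiff]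
      tauto
  have hdegsum : 4 * (d + 2) * (C r).card + 1 ≤ ∑ i ∈ Finset.range r, (E i).card := by
    refine le_trans ?_ ((Finset.card_le_card hcover).trans Finset.card_biUnion_le)
    have : (((C r) ×ˢ T).filter (fun p => G.Adj p.1 p.2)).card =
        ∑ x ∈ C r, (T.filter fun u => G.Adj x u).card := by
      rw [Finset.card_filter, Finset.sum_product]
      simp only [Finset.card_filter]
    rw [this]
    have h1 : ∑ x ∈ C r, (4 * (d + 2) + 1) ≤ ∑ x ∈ C r, (T.filter fun u => G.Adj x u).card :=
      Finset.sum_le_sum fun x hx => by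
        have := hdeg x (ballIn_subset r hx)
        omega
    rw [Finset.sum_const, smul_eq_mul] at h1
    have h2 : 1 ≤ (C r).card := by
      obtain ⟨m, rfl⟩ : ∃ m, r = m + 1 := ⟨r - 1, by omega⟩
      exact Finset.card_pos.2 ⟨v, self_mem_ballIn hv m⟩
    nlinarith
  have hsize : ∑ i ∈ Finset.range r, (C (i + 2) \ C i).card ≤ 4 * (C r).card := by
    have : ∀ n, ∑ i ∈ Finset.range n, (C (i + 2) \ C i).card ≤ (C n).card + (C (n + 1)).card := by
      intro n
      induction n with
      | zero => simp
      | succ n ih =>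
        rw [Finset.sum_range_succ]
        have := Finset.card_sdiff_add_card_eq_card (hmono (show n ≤ n + 2 by omega))
        show _ ≤ _ + (C (n + 2)).card
        omega
    have h1 := this r
    have h2 := Finset.card_le_card (hmono (show r ≤ r + 1 by omega))
    omega
  have hsum : ∑ i ∈ Finset.range r, (d + 2) * (C (i + 2) \ C i).card <
      ∑ i ∈ Finset.range r, (E i).card := by
    rw [← Finset.mul_sum]
    have := Nat.mul_le_mul_left (d + 2) hsize
    have e : (d + 2) * (4 * (C r).card) = 4 * (d + 2) * (C r).card := by ring
    omega
  obtain ⟨i, hi, hlt⟩ := Finset.exists_lt_of_sum_lt hsum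
  refine ⟨i, ?_, by have := Finset.mem_range.1 hi; omega, hlt⟩
  by_contra h0
  obtain rfl : i = 0 := by omega
  have hC1 : C 1 = {v} := by
    ext x
    rw [hC, show 1 = 0 + 1 from rfl, mem_ballIn_succ]
    simp only [ballIn, Finset.notMem_empty, false_and, exists_false, or_false,
      Finset.mem_singleton]
    exact ⟨fun h => h.2, fun h => ⟨h ▸ hv, h⟩⟩
  have hsub : E 0 ⊆ (C 2).image (fun u => (v, u)) ∪ (C 2).image (fun u => (u, v)) := by
    rintro ⟨x, y⟩ h
    simp only [hE, mem_adjPairs, Finset.mem_sdiff, edgesMeeting, hC1, zero_add] at h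
    simp only [Finset.mem_union, Finset.mem_image, Prod.mk.injEq]
    obtain ⟨⟨⟨hx, -⟩, hy, -⟩, -, h | h⟩ := h
    · left; exact ⟨y, hy, (Finset.mem_singleton.1 h.1).symm, rfl⟩
    · right; exact ⟨x, hx, rfl, (Finset.mem_singleton.1 h.1).symm⟩
  have h1 := (Finset.card_le_card hsub).trans (Finset.card_union_le _ _)
  have h2 := Finset.card_image_le (s := C 2) (f := fun u => (v, u))
  have h3 := Finset.card_image_le (s := C 2) (f := fun u => (u, v))
  have hC0 : C 0 = ∅ := rfl
  have hlt' : (d + 2) * (C 2).card < (E 0).card := by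
    simpa only [zero_add, hC0, Finset.sdiff_empty] using hlt
  nlinarith

/-- Dense graphs contain complete minors with branch sets of logarithmic size. -/
theorem exists_small_clique_minor.{u} (h : ℕ) : ∃ D L : ℕ, 0 < D ∧
    ∀ (α : Type u) (G : SimpleGraph α) (S : Finset α), S.Nonempty →
      D * S.card ≤ (adjPairs G S).card →
    ∃ B : Fin h → Finset α, (∀ i, B i ⊆ S) ∧ (∀ i, ConnSet G (B i : Set α)) ∧
      (∀ i, (B i).card ≤ L * (Nat.log 2 S.card + 1)) ∧
      (∀ i, ∃ a ∈ B i, ∃ b ∈ B i, G.Adj a b) ∧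
      (∀ i j, i ≠ j → Disjoint (B i) (B j) ∧ ∃ a ∈ B i, ∃ b ∈ B j, G.Adj a b) := by
  classical
  induction h with
  | zero => exact ⟨1, 0, one_pos, fun α G S _ _ => ⟨Fin.elim0, fun i => i.elim0, fun i => i.elim0,
      fun i => i.elim0, fun i => i.elim0, fun i => i.elim0⟩⟩
  | succ h ih =>
    obtain ⟨d, L, hd, ih⟩ := ih
    refine ⟨8 * (d + 2), L + h + 2, by omega, fun α G S₀ hS₀ hdense => ?_⟩
    obtain ⟨T, hTS, ⟨v, hv⟩, hdeg⟩ := exists_minimal_dense S₀ hS₀ hdense (by omega)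
    obtain ⟨i, hi1, hi2, hlt⟩ := exists_dense_layer hv hdeg
    obtain ⟨u₀, hu₀⟩ : (T.filter fun u => G.Adj v u).Nonempty := by
      rw [← Finset.card_pos]
      have := hdeg v hv
      omega
    obtain ⟨hu₀T, hvu₀⟩ := Finset.mem_filter.1 hu₀
    set C := ballIn G T v with hC
    set Γ := edgesMeeting G (C (i + 1) \ C i) with hΓ
    set S := C (i + 2) \ C i with hS
    have hvC : v ∈ C i := by
      obtain ⟨m, rfl⟩ : ∃ m, i = m + 1 := ⟨i - 1, by omega⟩
      exact self_mem_ballIn hv m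
    have hST : S ⊆ T := Finset.sdiff_subset.trans (ballIn_subset _)
    have hE' : d * S.card < (adjPairs Γ (S.erase u₀)).card := by
      have h1 := card_adjPairs_le_erase (G := Γ) S u₀
      have h2 := Finset.card_filter_le S (fun u => Γ.Adj u₀ u)
      have h3 : (d + 2) * S.card = d * S.card + 2 * S.card := by ring
      omega
    obtain ⟨B, hBS, hBc, hBcard, hBe, hBadj⟩ := ih α Γ (S.erase u₀) (by
        rw [Finset.nonempty_iff_ne_empty]
        intro h0
        rw [h0] at hE'
        simp [adjPairs] at hE') (by
        have := Nat.mul_le_mul_left d (Finset.card_le_card (Finset.erase_subset u₀ S))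
        omega)
    have hpath : ∀ j, ∃ P : Finset α, P ⊆ C i ∧ ConnSet G (P : Set α) ∧ v ∈ P ∧ P.card ≤ i ∧
        ∃ a ∈ P, ∃ b ∈ B j, G.Adj a b := by
      intro j
      obtain ⟨u, hu, huL⟩ : ∃ u ∈ B j, u ∈ C (i + 1) \ C i := by
        obtain ⟨a, ha, b, hb, hab⟩ := hBe j
        rcases hab.2 with h | h
        · exact ⟨a, ha, h⟩
        · exact ⟨b, hb, h⟩
      obtain ⟨hu1, hu2⟩ := Finset.mem_sdiff.1 huL
      obtain ⟨-, rfl | hu3 | ⟨y, hy, hyu⟩⟩ := mem_ballIn_succ.1 hu1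
      · exact absurd hvC hu2
      · exact absurd hu3 hu2
      · obtain ⟨P, h1, h2, h3, h4, h5⟩ := exists_connSet_of_mem_ballIn i y hy
        exact ⟨P, h1, h2, h3, h5, y, h4, u, hu, hyu⟩
    choose P hPC hPc hvP hPcard hPadj using hpath
    set hub : Finset α := {v, u₀} ∪ Finset.univ.biUnion P with hhub
    have hhubc : ConnSet G (hub : Set α) := by
      have : (hub : Set α) = {v, u₀} ∪ ⋃ j, (P j : Set α) := by
        simp [hhub, Set.insert_union]
      rw [this]
      exact ConnSet.union_iUnion (ConnSet.pair hvu₀) fun j =>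
        (ConnSet.pair hvu₀).union (hPc j) ⟨v, by simp, hvP j⟩
    have hhubcard : hub.card ≤ (L + h + 2) * (Nat.log 2 S₀.card + 1) := by
      have h1 : hub.card ≤ 2 + h * i := by
        refine (Finset.card_union_le _ _).trans (Nat.add_le_add Finset.card_le_two ?_)
        refine (Finset.card_biUnion_le_card_mul _ _ i fun j _ => hPcard j).trans ?_
        simp
      have h2 := Nat.log_mono_right (b := 2) (Finset.card_le_card hTS)
      have h3 : h * i ≤ h * (Nat.log 2 S₀.card + 1) := Nat.mul_le_mul_left _ (by omega)
      nlinarith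
    have hdisj : ∀ j, Disjoint hub (B j) := by
      intro j
      rw [Finset.disjoint_left]
      intro x hx hxB
      have hx' := Finset.mem_erase.1 (hBS j hxB)
      have hxC := (Finset.mem_sdiff.1 hx'.2).2
      simp only [hhub, Finset.mem_union, Finset.mem_insert, Finset.mem_singleton,
        Finset.mem_biUnion, Finset.mem_univ, true_and] at hx
      rcases hx with (rfl | rfl) | ⟨j', hx⟩
      · exact hxC hvC
      · exact hx'.1 rfl
      · exact hxC (hPC j' hx)
    have hhubadj : ∀ j, ∃ a ∈ hub, ∃ b ∈ B j, G.Adj a b := by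
      intro j
      obtain ⟨a, ha, b, hb, hab⟩ := hPadj j
      have ha_hub : a ∈ hub := by
        simp only [hhub, Finset.mem_union, Finset.mem_biUnion]
        exact Or.inr ⟨j, by simp, ha⟩
      exact ⟨a, ha_hub, b, hb, hab⟩
    refine ⟨Fin.cons hub B, ?_, ?_, ?_, ?_, ?_⟩
    · refine Fin.cases ?_ fun j => ?_
      · simp only [Fin.cons_zero, hhub]
        refine (Finset.union_subset ?_ ?_).trans hTS
        · intro x hx
          rcases Finset.mem_insert.1 hx with rfl | hx
          · exact hv
          · rwa [Finset.mem_singleton.1 hx]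
        · exact Finset.biUnion_subset.2 fun j _ => (hPC j).trans (ballIn_subset _)
      · simp only [Fin.cons_succ]
        exact ((hBS j).trans (Finset.erase_subset _ _)).trans (hST.trans hTS)
    · refine Fin.cases ?_ fun j => ?_
      · simpa using hhubc
      · simpa using (hBc j).mono_graph (edgesMeeting_le _)
    · refine Fin.cases ?_ fun j => ?_
      · simpa using hhubcard
      · simp only [Fin.cons_succ]
        refine (hBcard j).trans (Nat.mul_le_mul (by omega) ?_)
        have := Nat.log_mono_right (b := 2)
          (Finset.card_le_card ((Finset.erase_subset u₀ S).trans (hST.trans hTS)))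
        omega
    · refine Fin.cases ?_ fun j => ?_
      · simp only [Fin.cons_zero]
        exact ⟨v, by simp [hhub], u₀, by simp [hhub], hvu₀⟩
      · simp only [Fin.cons_succ]
        obtain ⟨a, ha, b, hb, hab⟩ := hBe j
        exact ⟨a, ha, b, hb, hab.1⟩
    · refine Fin.cases (Fin.cases ?_ fun j => ?_) fun j => Fin.cases ?_ fun j' => ?_
      · exact fun h => absurd rfl h
      · intro _
        simp only [Fin.cons_zero, Fin.cons_succ]
        exact ⟨hdisj j, hhubadj j⟩
      · intro _
        simp only [Fin.cons_zero, Fin.cons_succ]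
        obtain ⟨a, ha, b, hb, hab⟩ := hhubadj j
        exact ⟨(hdisj j).symm, b, hb, a, ha, hab.symm⟩
      · intro hne
        simp only [Fin.cons_succ]
        obtain ⟨h1, a, ha, b, hb, hab⟩ := hBadj j j' fun h => hne (by rw [h])
        exact ⟨h1, a, ha, b, hb, hab.1⟩

end density

section peeling
variable {α ι : Type*} {G : SimpleGraph α} {T : SimpleGraph ι} {bag : ι → Set α}

/-- The nodes whose bags meet a connected set form a connected set. -/
theorem IsTreeDecomp.connSet_nodes (hdec : IsTreeDecomp G T bag) {F : Set α} (hF : ConnSet G F) :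
    ConnSet T {t | (bag t ∩ F).Nonempty} := by
  obtain ⟨hcov, hedge, hsub⟩ := hdec
  have hsub' : ∀ v, ConnSet T {t | v ∈ bag t} := fun v =>
    (connSet_iff_induce_connected _ _).2 (hsub v)
  obtain ⟨x, hx⟩ := hF.nonempty
  obtain ⟨t₀, ht₀⟩ := hcov x
  refine ⟨⟨t₀, x, ht₀, hx⟩, ?_⟩
  rintro Q ⟨q, ⟨y, hyq, hyF⟩, hqQ⟩ hcl
  have key : ∀ v ∈ F, ∀ s, v ∈ bag s → s ∈ Q → {t | v ∈ bag t} ⊆ Q := fun v hv s hs hsQ =>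
    (hsub' v).subset_of_closed hs hsQ fun a ha haQ b hb =>
      hcl a ⟨v, ha, hv⟩ haQ b ⟨v, hb, hv⟩
  have hall : F ⊆ {v | {t | v ∈ bag t} ⊆ Q} := by
    refine hF.subset_of_closed hyF (key y hyF q hyq hqQ) ?_
    intro u hu huQ v hv huv
    obtain ⟨s, hus, hvs⟩ := hedge u v huv
    exact key v hv s hvs (huQ hus)
  rintro t ⟨v, hvt, hvF⟩
  exact hall hvF hvt

/-- A node `t` of a tree together with the side of the tree hanging below it. -/
theorem exists_side_of_tree (hT : T.IsTree) (r t : ι) : ∃ Q : Set ι, t ∈ Q ∧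
    (∀ s ∈ Q, s ≠ t → T.dist t r < T.dist s r) ∧
    (∀ u ∈ Q, ∀ v, T.Adj u v → u ≠ t → v ∈ Q) ∧
    (∀ u ∈ Q, ∀ v, T.Adj u v → T.dist t r ≤ T.dist v r → v ∈ Q) := by
  by_cases htr : t = r
  · subst htr
    refine ⟨Set.univ, trivial, fun s _ hs => ?_, fun _ _ _ _ _ => trivial,
      fun _ _ _ _ _ => trivial⟩
    rw [dist_self]
    exact hT.1.pos_dist_of_ne hs
  · obtain ⟨w, hw⟩ := hT.1.exists_walk_length_eq_dist t r
    cases w with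
    | nil => exact absurd rfl htr
    | @cons _ a _ hta p =>
      rw [Walk.length_cons] at hw
      have htp : t ∉ p.support := by
        classical
        intro h
        have h1 := dist_le (p.dropUntil t h)
        have h2 := p.length_dropUntil_le_length h
        omega
      have hbr := isBridge_iff.1 (isAcyclic_iff_forall_adj_isBridge.1 hT.2 hta)
      set T' := T.deleteEdges {s(t, a)} with hT'
      have hadj' : ∀ u v, T.Adj u v → s(u, v) ≠ s(t, a) → T'.Adj u v := by
        intro u v huv hne
        simp [hT', huv, hne]
      have hra : T'.Reachable a r := by
        have : ∀ (x y : ι) (q : T.Walk x y), t ∉ q.support → T'.Reachable x y := by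
          intro x y q
          induction q with
          | nil => exact fun _ => Reachable.refl _
          | @cons x z _ hxz q ih =>
            intro ht
            rw [Walk.support_cons, List.mem_cons, not_or] at ht
            refine (Adj.reachable (hadj' _ _ hxz ?_)).trans (ih ht.2)
            intro he
            rw [Sym2.eq_iff] at he
            rcases he with ⟨rfl, -⟩ | ⟨-, rfl⟩
            · exact ht.1 rfl
            · exact ht.2 q.start_mem_support
        exact this a r p htp
      have hda : T.dist a r < T.dist t r := by
        have := dist_le p
        omega
      have hstep : ∀ u, T'.Reachable t u → ∀ v, T.Adj u v → ¬ T'.Reachable t v → u = t ∧ v = a := by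
        intro u hu v huv hv
        by_contra hne
        refine hv (hu.trans (Adj.reachable (hadj' _ _ huv fun he => ?_)))
        rcases Sym2.eq_iff.1 he with h | ⟨rfl, rfl⟩
        · exact hne h
        · exact hbr hu
      refine ⟨{s | T'.Reachable t s}, Reachable.refl _, ?_, ?_, ?_⟩
      · intro s hs hst
        have hthrough : ∀ (x y : ι) (q : T.Walk x y), T'.Reachable t x → ¬ T'.Reachable t y →
            t ∈ q.support := by
          intro x y q
          induction q with
          | nil => exact fun h h' => absurd h h'
          | @cons x z _ hxz q ih =>
            intro hx hy
            rw [Walk.support_cons, List.mem_cons]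
            by_cases hz : T'.Reachable t z
            · exact Or.inr (ih hz hy)
            · exact Or.inl (hstep _ hx _ hxz hz).1.symm
        obtain ⟨q, hq⟩ := hT.1.exists_walk_length_eq_dist s r
        have hmem := hthrough _ _ q hs fun h => hbr (h.trans hra.symm)
        classical
        have h1 := congrArg Walk.length (q.take_spec hmem)
        rw [Walk.length_append] at h1
        have h2 := dist_le (q.dropUntil t hmem)
        have h3 : (q.takeUntil t hmem).length ≠ 0 := fun h => hst (Walk.eq_of_length_eq_zero h)
        omega
      · intro u hu v huv hut
        by_contra hv
        exact hut (hstep u hu v huv hv).1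
      · intro u hu v huv hd
        by_contra hv
        obtain ⟨-, rfl⟩ := hstep u hu v huv hv
        omega

/-- Given a nonempty collection of connected sets, some bag of a tree decomposition separates a
part of the graph that contains a member of the collection, but none after removing the bag. -/
theorem IsTreeDecomp.exists_peel [Finite α] (hT : T.IsTree) (hdec : IsTreeDecomp G T bag)
    (P : Set α → Prop) (hP : ∀ F, P F → ConnSet G F) (hex : ∃ F, P F) :
    ∃ t, ∃ D : Set α, Disjoint D (bag t) ∧ (∀ u ∈ D, ∀ v, G.Adj u v → v ∈ D ∪ bag t) ∧
      (∃ F, P F ∧ F ⊆ D ∪ bag t) ∧ ∀ F, P F → ¬ F ⊆ D := by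
  obtain ⟨r⟩ := hT.1.nonempty
  set d : Set α → ℕ := fun F => sInf {n | ∃ t, T.dist t r = n ∧ (bag t ∩ F).Nonempty} with hd
  have hdle : ∀ F t, (bag t ∩ F).Nonempty → d F ≤ T.dist t r := fun F t h =>
    Nat.sInf_le ⟨t, rfl, h⟩
  have hdmem : ∀ F, P F → ∃ t, T.dist t r = d F ∧ (bag t ∩ F).Nonempty := by
    intro F hF
    obtain ⟨x, hx⟩ := (hP F hF).nonempty
    obtain ⟨t, ht⟩ := hdec.1 x
    exact Nat.sInf_mem (s := {n | ∃ t, T.dist t r = n ∧ (bag t ∩ F).Nonempty})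
      ⟨_, t, rfl, ⟨x, ht, hx⟩⟩
  obtain ⟨F, hF, hmax⟩ := Set.exists_max_image {F | P F} d (Set.toFinite _) hex
  obtain ⟨t, htd, htF⟩ := hdmem F hF
  obtain ⟨Q, htQ, hQd, hQ1, hQ2⟩ := exists_side_of_tree hT r t
  refine ⟨t, {v | v ∉ bag t ∧ ∀ s, v ∈ bag s → s ∈ Q}, ?_, ?_, ⟨F, hF, ?_⟩, ?_⟩
  · exact Set.disjoint_left.2 fun v hv => hv.1
  · rintro u ⟨hut, huQ⟩ v huv
    by_cases hvt : v ∈ bag t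
    · exact Or.inr hvt
    · refine Or.inl ⟨hvt, ?_⟩
      obtain ⟨s, hus, hvs⟩ := hdec.2.1 u v huv
      have := (connSet_iff_induce_connected T _).2 (hdec.2.2 v)
      refine fun s' hs' => this.subset_of_closed hvs (huQ s hus) ?_ hs'
      intro a ha haQ b hb hab
      exact hQ1 a haQ b hab fun h => hvt (h ▸ ha)
  · intro v hv
    by_cases hvt : v ∈ bag t
    · exact Or.inr hvt
    · refine Or.inl ⟨hvt, ?_⟩
      have hsub := (hdec.connSet_nodes (hP F hF)).subset_of_closed htF htQ
        fun a _ haQ b hb hab => hQ2 a haQ b hab (htd ▸ hdle F b hb)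
      exact fun s hs => hsub ⟨v, hs, hv⟩
  · intro F' hF' hsub
    obtain ⟨s, hsd, v, hvs, hvF⟩ := hdmem F' hF'
    have hv := hsub hvF
    have h1 := hQd s (hv.2 s hvs) fun h => hv.1 (h ▸ hvs)
    have h2 := hmax F' hF'
    omega

end peeling

/-- A finite graph has a tree decomposition whose bags have at most `treewidth G + 1` vertices. -/
theorem exists_isTreeDecomp {α : Type*} (G : SimpleGraph α) :
    ∃ (ι : Type) (T : SimpleGraph ι) (bag : ι → Set α),
      T.IsTree ∧ IsTreeDecomp G T bag ∧ ∀ t, (bag t).ncard ≤ treewidth G + 1 := by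
  refine Nat.sInf_mem (s := {w | ∃ (ι : Type) (T : SimpleGraph ι) (X : ι → Set α),
    T.IsTree ∧ IsTreeDecomp G T X ∧ ∀ t, (X t).ncard ≤ w + 1})
    ⟨(Set.univ : Set α).ncard, Unit, ⊥, fun _ => Set.univ, ?_, ⟨?_, ?_, ?_⟩, ?_⟩
  · exact ⟨⟨fun a b => by rw [Subsingleton.elim a b]⟩, isAcyclic_bot⟩
  · exact fun v => ⟨(), trivial⟩
  · exact fun u v _ => ⟨(), trivial, trivial⟩
  · intro v
    rw [← connSet_iff_induce_connected]
    convert ConnSet.singleton _ ()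
    ext ⟨⟩
    simp
  · exact fun t => Nat.le_succ _

section cheap
variable {α : Type*} {G : SimpleGraph α} {X : Set α}

/-- The vertices outside `A` with a neighbour in `A`. -/
def outerBoundary (G : SimpleGraph α) (A : Set α) : Set α := {v | v ∉ A ∧ ∃ u ∈ A, G.Adj u v}

/-- `P` can be separated from the rest of the graph by deleting at most `s` vertices, up to a part
of the graph avoiding `X`. -/
def Cheap (G : SimpleGraph α) (X P : Set α) (s : ℕ) : Prop :=
  ∃ S D : Set α, P ⊆ S ∪ D ∧ S.ncard ≤ s ∧ Disjoint D X ∧ ∀ u ∈ D, ∀ v, G.Adj u v → v ∈ S ∪ D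

theorem Cheap.mono {P P' : Set α} {s s' : ℕ} (h : Cheap G X P s) (hP : P' ⊆ P) (hs : s ≤ s') :
    Cheap G X P' s' := by
  obtain ⟨S, D, h1, h2, h3, h4⟩ := h
  exact ⟨S, D, hP.trans h1, h2.trans hs, h3, h4⟩

theorem cheap_empty (s : ℕ) : Cheap G X ∅ s := ⟨∅, ∅, by simp⟩

theorem cheap_singleton (a : α) : Cheap G X {a} 1 := ⟨{a}, ∅, by simp⟩

theorem Cheap.union {P P' : Set α} {s s' : ℕ} (h : Cheap G X P s) (h' : Cheap G X P' s') :
    Cheap G X (P ∪ P') (s + s') := by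
  obtain ⟨S, D, h1, h2, h3, h4⟩ := h
  obtain ⟨S', D', h1', h2', h3', h4'⟩ := h'
  refine ⟨S ∪ S', D ∪ D', ?_, (Set.ncard_union_le _ _).trans (Nat.add_le_add h2 h2'),
    Set.disjoint_union_left.2 ⟨h3, h3'⟩, ?_⟩
  · rintro x (hx | hx)
    · rcases h1 hx with h | h <;> simp [h]
    · rcases h1' hx with h | h <;> simp [h]
  · rintro u (hu | hu) v huv
    · rcases h4 u hu v huv with h | h <;> simp [h]
    · rcases h4' u hu v huv with h | h <;> simp [h]

theorem cheap_biUnion {ι : Type*} (I : Finset ι) (P : ι → Set α) (c : ℕ)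
    (h : ∀ i ∈ I, Cheap G X (P i) c) : Cheap G X (⋃ i ∈ I, P i) (I.card * c) := by
  classical
  induction I using Finset.induction_on with
  | empty => simpa using cheap_empty 0
  | insert a I ha ih =>
    rw [Finset.set_biUnion_insert, Finset.card_insert_of_notMem ha, add_mul, one_mul, add_comm]
    exact (h a (by simp)).union (ih fun i hi => h i (by simp [hi]))

/-- Some separation of order at most `b` of `G - X` cuts off a member of a given collection of
connected sets, minimally so. -/
def HasMinimalCuts (G : SimpleGraph α) (X : Set α) (b : ℕ) : Prop :=
  ∀ P : Set α → Prop, (∀ F, P F → ConnSet G F ∧ Disjoint F X) → (∃ F, P F) →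
    ∃ B D : Set α, Disjoint D B ∧ Disjoint D X ∧ Disjoint B X ∧ B.ncard ≤ b ∧
      (∀ u ∈ D, ∀ v, v ∉ X → G.Adj u v → v ∈ D ∪ B) ∧ (∃ F, P F ∧ F ⊆ D ∪ B) ∧
      ∀ F, P F → ¬ F ⊆ D

theorem hasMinimalCuts_of_treewidth [Finite α] {b : ℕ} (h : treewidth (G.induce Xᶜ) < b) :
    HasMinimalCuts G X b := by
  intro P hP hex
  obtain ⟨ι, T, bag, hT, hdec, hbag⟩ := exists_isTreeDecomp (G.induce Xᶜ)
  have himg : ∀ F, P F → Subtype.val '' (Subtype.val ⁻¹' F : Set ↑Xᶜ) = F := by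
    intro F hF
    rw [Subtype.image_preimage_coe, Set.inter_eq_right]
    exact fun x hx hxX => Set.disjoint_left.1 (hP F hF).2 hx hxX
  obtain ⟨t, D, h1, h2, ⟨F, hF, hFD⟩, h4⟩ := hdec.exists_peel hT (fun F => P (Subtype.val '' F))
    (fun F hF => ConnSet.image_iff.1 (hP _ hF).1) (by
      obtain ⟨F, hF⟩ := hex
      exact ⟨Subtype.val ⁻¹' F, by rwa [himg F hF]⟩)
  refine ⟨Subtype.val '' bag t, Subtype.val '' D,
    (Set.disjoint_image_iff Subtype.val_injective).2 h1, ?_, ?_, ?_, ?_, ⟨_, hF, ?_⟩, ?_⟩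
  · rw [Set.disjoint_left]
    rintro _ ⟨x, -, rfl⟩
    exact x.2
  · rw [Set.disjoint_left]
    rintro _ ⟨x, -, rfl⟩
    exact x.2
  · rw [Set.ncard_image_of_injective _ Subtype.val_injective]
    exact (hbag t).trans h
  · rintro _ ⟨u, hu, rfl⟩ v hv huv
    rw [← Set.image_union]
    exact ⟨⟨v, hv⟩, h2 u hu ⟨v, hv⟩ huv, rfl⟩
  · rw [← Set.image_union]
    exact Set.image_mono hFD
  · intro F hF hsub
    refine h4 (Subtype.val ⁻¹' F) (by rwa [himg F hF]) fun x hx => ?_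
    obtain ⟨y, hy, hyx⟩ := hsub hx
    rwa [← Subtype.ext hyx]

end cheap

section quotient
variable {α : Type*} {G : SimpleGraph α} {cl : α → Set α}

/-- The graph obtained by contracting the clusters `cl y`. -/
def clusterGraph (G : SimpleGraph α) (cl : α → Set α) : SimpleGraph α where
  Adj x y := x ≠ y ∧ ∃ a ∈ cl x, ∃ b ∈ cl y, G.Adj a b
  symm := ⟨fun _ _ ⟨h, a, ha, b, hb, hab⟩ => ⟨h.symm, b, hb, a, ha, hab.symm⟩⟩
  loopless := ⟨fun _ h => h.1 rfl⟩

theorem ConnSet.biUnion_cluster {A : Set α} (hA : ConnSet (clusterGraph G cl) A)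
    (hcl : ∀ y ∈ A, ConnSet G (cl y)) : ConnSet G (⋃ y ∈ A, cl y) := by
  obtain ⟨y₀, hy₀⟩ := hA.nonempty
  obtain ⟨a, ha⟩ := (hcl y₀ hy₀).nonempty
  refine ⟨⟨a, Set.mem_biUnion hy₀ ha⟩, ?_⟩
  rintro Q ⟨q, hq, hqQ⟩ hclosed
  have key : ∀ y ∈ A, ∀ x ∈ cl y, x ∈ Q → cl y ⊆ Q := fun y hy x hx hxQ =>
    (hcl y hy).subset_of_closed hx hxQ fun u hu huQ v hv =>
      hclosed u (Set.mem_biUnion hy hu) huQ v (Set.mem_biUnion hy hv)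
  obtain ⟨y₁, hy₁, hqy₁⟩ := Set.mem_iUnion₂.1 hq
  refine Set.iUnion₂_subset (hA.subset_of_closed (Q := {y | cl y ⊆ Q}) hy₁
    (key y₁ hy₁ q hqy₁ hqQ) ?_)
  rintro u hu huQ v hv ⟨-, a, ha, b, hb, hab⟩
  exact key v hv b hb
    (hclosed a (Set.mem_biUnion hu ha) (huQ ha) b (Set.mem_biUnion hv hb) hab)

end quotient

/-- A model of the complete graph on `h` vertices. -/
def IsCliqueModel {α : Type*} (G : SimpleGraph α) {h : ℕ} (B : Fin h → Set α) : Prop :=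
  (∀ i, ConnSet G (B i)) ∧
    ∀ i j, i ≠ j → Disjoint (B i) (B j) ∧ ∃ a ∈ B i, ∃ b ∈ B j, G.Adj a b

theorem Nat.log_two_mul_le (K F : ℕ) : Nat.log 2 (K * F) ≤ K + Nat.log 2 F := by
  refine Nat.lt_add_one_iff.1 (Nat.log_lt_of_lt_pow' (by omega) ?_)
  have h1 : K < 2 ^ K := Nat.lt_two_pow_self
  have h2 := Nat.lt_pow_succ_log_self (b := 2) (by norm_num) F
  rw [Nat.succ_eq_add_one] at h2
  rw [add_assoc, pow_add]
  exact Nat.mul_lt_mul'' h1 h2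

section reduction
variable {α : Type*} {G : SimpleGraph α} {X : Set α}

/-- A stage of the process replacing `G - U` by clusters: every vertex outside `U ∪ Y` lies
in a piece attached to few vertices of `Y`, and the cluster graph on `S` has many edges. -/
structure PeelingStage (G : SimpleGraph α) (X : Set α) (b p q d m : ℕ) (U Y : Set α) (S : Finset α)
    (cl : α → Set α) : Prop where
  subset : X ⊆ Y
  disjoint : Disjoint Y U
  mem_cl : ∀ y ∈ S, y ∈ cl y
  connSet_cl : ∀ y ∈ S, ConnSet G (cl y)
  disjoint_cl : ∀ y ∈ S, Disjoint (cl y) U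
  cheap_cl : ∀ y ∈ S, Cheap G X (cl y) q
  ncard_cl : ∀ y ∈ S, (cl y ∩ Y).ncard ≤ b
  pairwise_cl : ∀ y ∈ S, ∀ z ∈ S, y ≠ z → Disjoint (cl y) (cl z)
  cover : Y ⊆ ⋃ y ∈ S, cl y
  ncard_Y : Y.ncard ≤ X.ncard + b * m
  card_S : S.card ≤ X.ncard + b * m
  adj_U : ∀ u ∈ U, ∀ v, v ∉ U → G.Adj u v → v ∈ Y
  pieces : ∀ v, v ∉ U → v ∉ Y → ∃ D N : Set α, v ∈ D ∧ Disjoint D U ∧ Disjoint D Y ∧ N ⊆ Y ∧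
    N.ncard ≤ p + b ∧ ∀ u ∈ D, ∀ w, G.Adj u w → w ∈ D ∪ N
  edges : m * d ≤ (adjPairs (clusterGraph G cl) S).card

theorem PeelingStage.initial [Finite α] {b p q d : ℕ} (hb : 1 ≤ b) (hq : 1 ≤ q) :
    PeelingStage G X b p q d 0 Xᶜ X X.toFinite.toFinset (fun y => {y}) where
  subset := subset_rfl
  disjoint := disjoint_compl_right
  mem_cl _ _ := rfl
  connSet_cl y _ := ConnSet.singleton G y
  disjoint_cl y hy := by
    have : y ∈ X := by simpa using hy
    simpa using this
  cheap_cl y _ := (cheap_singleton y).mono subset_rfl hq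
  ncard_cl y _ := (Set.ncard_le_ncard Set.inter_subset_left).trans (by simpa using hb)
  pairwise_cl y _ z _ h := by simpa using h
  cover x hx := by simpa using hx
  ncard_Y := by simp
  card_S := by simp [Set.ncard_eq_toFinset_card X]
  adj_U u _ v hv _ := by simpa using hv
  pieces v hv hv' := absurd (by simpa using hv) hv'
  edges := by simp

open Classical in
theorem PeelingStage.step [Finite α] {b d m : ℕ} (hpeel : HasMinimalCuts G X b) (hb : 1 ≤ b)
    {U Y : Set α} {S : Finset α} {cl : α → Set α} {p q : ℕ} (hp : p = d * b)
    (hq : q = 1 + p * (p + b)) (hst : PeelingStage G X b p q d m U Y S cl)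
    (hex : ∃ F, F ⊆ U ∧ ConnSet G F ∧ p ≤ (outerBoundary G F \ U).ncard) :
    ∃ U' Y' S' cl', PeelingStage G X b p q d (m + 1) U' Y' S' cl' := by
  have hUX : Disjoint U X := (hst.disjoint.mono_left hst.subset).symm
  set 𝓕 : Set α → Prop := fun F => F ⊆ U ∧ ConnSet G F ∧ p ≤ (outerBoundary G F \ U).ncard with h𝓕
  obtain ⟨B₀, D₀, hDB₀, -, -, hB₀, hcl₀, ⟨F₀, hF₀, hF₀sub⟩, hno⟩ :=
    hpeel 𝓕 (fun F hF => ⟨hF.2.1, hUX.mono_left hF.1⟩) hex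
  set B := B₀ ∩ U with hB
  set D := D₀ ∩ U with hD
  have hBU : B ⊆ U := Set.inter_subset_right
  have hDU : D ⊆ U := Set.inter_subset_right
  have hDB : Disjoint D B := hDB₀.mono Set.inter_subset_left Set.inter_subset_left
  have hBcard : B.ncard ≤ b := (Set.ncard_le_ncard Set.inter_subset_left).trans hB₀
  have hclD : ∀ u ∈ D, ∀ v ∈ U, G.Adj u v → v ∈ D ∪ B := by
    intro u hu v hv huv
    rcases hcl₀ u hu.1 v (fun h => Set.disjoint_left.1 hUX hv h) huv with h | h
    · exact Or.inl ⟨h, hv⟩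
    · exact Or.inr ⟨h, hv⟩
  obtain ⟨D', hDD', hmax⟩ :=
    (Set.toFinite {E : Set α | E ⊆ D ∪ B ∧ ∀ F, 𝓕 F → ¬ F ⊆ E}).exists_le_maximal
    (show D ∈ _ from
      ⟨Set.subset_union_left, fun F hF h => hno F hF (h.trans Set.inter_subset_left)⟩)
  obtain ⟨hD'sub, hD'no⟩ := hmax.prop
  have hD'U : D' ⊆ U := hD'sub.trans (Set.union_subset hDU hBU)
  obtain ⟨b₁, hb₁, hb₁D'⟩ : ∃ b₁ ∈ D ∪ B, b₁ ∉ D' := by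
    by_contra! h
    refine hD'no F₀ hF₀ fun x hx => h x ?_
    rcases hF₀sub hx with h' | h'
    · exact Or.inl ⟨h', hF₀.1 hx⟩
    · exact Or.inr ⟨h', hF₀.1 hx⟩
  have hb₁B : b₁ ∈ B := hb₁.resolve_left fun h => hb₁D' (hDD' h)
  obtain ⟨F, hF, hFsub⟩ : ∃ F, 𝓕 F ∧ F ⊆ insert b₁ D' := by
    by_contra! h
    have hmem : insert b₁ D' ∈ {E : Set α | E ⊆ D ∪ B ∧ ∀ F, 𝓕 F → ¬ F ⊆ E} :=
      ⟨Set.insert_subset hb₁ hD'sub, h⟩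
    exact hb₁D' (hmax.le_of_ge hmem (Set.subset_insert _ _) (Set.mem_insert _ _))
  have hb₁F : b₁ ∈ F := by
    by_contra h
    exact hD'no F hF fun x hx => (hFsub hx).resolve_left fun h' => h (h' ▸ hx)
  obtain ⟨W, hWsub, hWcard⟩ := Set.exists_subset_card_eq hF.2.2
  have hWfin : W.Finite := Set.toFinite W
  have hwit : ∀ w, ∃ u, w ∈ W → u ∈ F ∧ G.Adj u w := by
    intro w
    by_cases hw : w ∈ W
    · obtain ⟨⟨-, u, hu, huw⟩, -⟩ := hWsub hw
      exact ⟨u, fun _ => ⟨hu, huw⟩⟩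
    · exact ⟨w, fun h => absurd h hw⟩
  choose f hf using hwit
  have hWY : W ⊆ Y := fun w hw =>
    hst.adj_U (f w) (hF.1 (hf w hw).1) w (hWsub hw).2 (hf w hw).2
  have hcompcheap : ∀ v, Cheap G X (compIn G D' v) (p + b) := by
    intro v
    by_cases hv : v ∈ D'
    · have hK := connSet_compIn (G := G) hv
      have hKD' : compIn G D' v ⊆ D' := compIn_subset
      have hKsmall : (outerBoundary G (compIn G D' v) \ U).ncard ≤ p := by
        by_contra! h
        exact hD'no _ ⟨hKD'.trans hD'U, hK, h.le⟩ hKD'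
      refine ⟨(outerBoundary G (compIn G D' v) \ U) ∪ B, compIn G D' v \ B, ?_,
        (Set.ncard_union_le _ _).trans (Nat.add_le_add hKsmall hBcard), ?_, ?_⟩
      · intro x hx
        by_cases hxB : x ∈ B
        · exact Or.inl (Or.inr hxB)
        · exact Or.inr ⟨hx, hxB⟩
      · exact hUX.mono_left (Set.sdiff_subset.trans (hKD'.trans hD'U))
      · rintro u ⟨hu, huB⟩ w huw
        by_cases hwU : w ∈ U
        · rcases hclD u ((hD'sub (hKD' hu)).resolve_right huB) w hwU huw with h | h
          · exact Or.inr ⟨mem_compIn_of_adj hu (hDD' h) huw, Set.disjoint_left.1 hDB h⟩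
          · exact Or.inl (Or.inr h)
        · exact Or.inl (Or.inl ⟨⟨fun h => hwU (hD'U (hKD' h)), u, hu, huw⟩, hwU⟩)
    · have : compIn G D' v = ∅ := by
        ext x
        simp only [Set.mem_empty_iff_false, iff_false]
        rintro ⟨c, hc, -, hvc, -⟩
        exact hv (hc hvc)
      rw [this]
      exact cheap_empty _
  set blob : Set α := {b₁} ∪ ⋃ w : hWfin.toFinset, compIn G D' (f w) with hblob
  have hblobsub : blob ⊆ D ∪ B := by
    refine Set.union_subset (by simpa using hb₁) (Set.iUnion_subset fun w => ?_)
    exact compIn_subset.trans hD'sub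
  have hblobU : blob ⊆ U := hblobsub.trans (Set.union_subset hDU hBU)
  have hb₁blob : b₁ ∈ blob := Or.inl rfl
  have hblobconn : ConnSet G blob := by
    refine ConnSet.union_iUnion (ConnSet.singleton G b₁) ?_
    rintro ⟨w, hw⟩
    have hw' : w ∈ W := by simpa using hw
    by_cases hv : f w ∈ D'
    · by_cases hadj : ∃ u ∈ compIn G D' (f w), G.Adj u b₁
      · obtain ⟨u, hu, hub⟩ := hadj
        exact (ConnSet.singleton G b₁).union_adj (connSet_compIn hv) rfl hu hub.symm
      · exfalso
        push Not at hadj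
        have := hF.2.1.subset_of_closed (hf w hw').1 (mem_compIn_self (G := G) hv) ?_
        · exact hb₁D' (compIn_subset (this hb₁F))
        · intro u _ hu v hvF huv
          rcases hFsub hvF with rfl | h
          · exact absurd huv (hadj u hu)
          · exact mem_compIn_of_adj hu h huv
    · have : compIn G D' (f w) = ∅ := by
        ext x
        simp only [Set.mem_empty_iff_false, iff_false]
        rintro ⟨c, hc, -, hvc, -⟩
        exact hv (hc hvc)
      simpa only [this, Set.union_empty] using ConnSet.singleton G b₁
  have hblobcheap : Cheap G X blob q := by
    have h1 := cheap_biUnion (X := X) (G := G) hWfin.toFinset (fun w => compIn G D' (f w)) (p + b)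
      fun w _ => hcompcheap _
    rw [← Set.ncard_eq_toFinset_card W hWfin, hWcard] at h1
    refine ((cheap_singleton b₁).union h1).mono ?_ hq.ge
    refine Set.union_subset_union_right _ (Set.iUnion_subset ?_)
    rintro ⟨w, hw⟩
    exact Set.subset_biUnion_of_mem (u := fun w => compIn G D' (f w)) hw
  have hfblob : ∀ w ∈ W, f w ∈ blob := by
    intro w hw
    rcases hFsub (hf w hw).1 with h | h
    · exact Or.inl h
    · exact Or.inr (Set.mem_iUnion.2 ⟨⟨w, by simpa using hw⟩, mem_compIn_self h⟩)
  have hSU : ∀ y ∈ S, y ∉ U := fun y hy =>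
    Set.disjoint_left.1 (hst.disjoint_cl y hy) (hst.mem_cl y hy)
  have hb₁S : b₁ ∉ S := fun h => hSU b₁ h (hBU hb₁B)
  set cl' : α → Set α := fun y => if y ∈ S then cl y else if y = b₁ then blob else {y} with hcl'
  set S' : Finset α := S ∪ (insert b₁ (B \ blob)).toFinite.toFinset with hS'
  have hclS : ∀ y ∈ S, cl' y = cl y := fun y hy => by simp [hcl', hy]
  have hclb : cl' b₁ = blob := by simp [hcl', hb₁S]
  have hclB : ∀ y ∈ B \ blob, cl' y = {y} := by
    rintro y ⟨hy, hy'⟩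
    have h1 : y ∉ S := fun h => hSU y h (hBU hy)
    have h2 : y ≠ b₁ := fun h => hy' (h ▸ hb₁blob)
    simp [hcl', h1, h2]
  have hmemS' : ∀ y, y ∈ S' ↔ y ∈ S ∨ y = b₁ ∨ y ∈ B \ blob := by
    intro y
    simp [hS']
    tauto
  have hclU : ∀ y ∈ S', y ∉ S → cl' y ⊆ D ∪ B := by
    intro y hy hyS
    rcases (hmemS' y).1 hy with h | rfl | h
    · exact absurd h hyS
    · rwa [hclb]
    · rw [hclB y h]
      simpa using Or.inr h.1
  have hDBU : D ∪ B ⊆ U := Set.union_subset hDU hBU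
  refine ⟨U \ (D ∪ B), Y ∪ B, S', cl', ?_⟩
  constructor
  · exact hst.subset.trans Set.subset_union_left
  · refine Set.disjoint_union_left.2 ⟨hst.disjoint.mono_right Set.sdiff_subset, ?_⟩
    exact Set.disjoint_left.2 fun x hx hx' => hx'.2 (Or.inr hx)
  · intro y hy
    rcases (hmemS' y).1 hy with h | rfl | h
    · rw [hclS y h]; exact hst.mem_cl y h
    · rwa [hclb]
    · rw [hclB y h]; rfl
  · intro y hy
    rcases (hmemS' y).1 hy with h | rfl | h
    · rw [hclS y h]; exact hst.connSet_cl y h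
    · rwa [hclb]
    · rw [hclB y h]; exact ConnSet.singleton G y
  · intro y hy
    by_cases h : y ∈ S
    · rw [hclS y h]; exact (hst.disjoint_cl y h).mono_right Set.sdiff_subset
    · exact Set.disjoint_left.2 fun x hx hx' => hx'.2 (hclU y hy h hx)
  · intro y hy
    rcases (hmemS' y).1 hy with h | rfl | h
    · rw [hclS y h]; exact hst.cheap_cl y h
    · rwa [hclb]
    · rw [hclB y h]; exact (cheap_singleton y).mono subset_rfl (by omega)
  · intro y hy
    by_cases h : y ∈ S
    · rw [hclS y h]
      refine (Set.ncard_le_ncard ?_).trans (hst.ncard_cl y h)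
      rintro x ⟨hx, hx' | hx'⟩
      · exact ⟨hx, hx'⟩
      · exact absurd (hBU hx') (Set.disjoint_left.1 (hst.disjoint_cl y h) hx)
    · refine (Set.ncard_le_ncard ?_).trans hBcard
      rintro x ⟨hx, hx' | hx'⟩
      · exact absurd (hDBU (hclU y hy h hx)) (Set.disjoint_left.1 hst.disjoint hx')
      · exact hx'
  · have hmix : ∀ y ∈ S, ∀ z ∈ S', z ∉ S → Disjoint (cl' y) (cl' z) := by
      intro y hy z hz hzS
      rw [hclS y hy]
      exact (hst.disjoint_cl y hy).mono_right ((hclU z hz hzS).trans hDBU)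
    intro y hy z hz hyz
    by_cases hyS : y ∈ S
    · by_cases hzS : z ∈ S
      · rw [hclS y hyS, hclS z hzS]
        exact hst.pairwise_cl y hyS z hzS hyz
      · exact hmix y hyS z hz hzS
    · by_cases hzS : z ∈ S
      · exact (hmix z hzS y hy hyS).symm
      · rcases ((hmemS' y).1 hy).resolve_left hyS with rfl | hy' <;>
          rcases ((hmemS' z).1 hz).resolve_left hzS with rfl | hz'
        · exact absurd rfl hyz
        · rw [hclb, hclB z hz']
          simpa using hz'.2
        · rw [hclb, hclB y hy']
          simpa using hy'.2
        · rw [hclB y hy', hclB z hz']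
          simpa using hyz
  · rintro x (hx | hx)
    · obtain ⟨y, hy, hxy⟩ := Set.mem_iUnion₂.1 (hst.cover hx)
      exact Set.mem_biUnion ((hmemS' y).2 (Or.inl hy)) (by rwa [hclS y hy])
    · by_cases hxb : x ∈ blob
      · exact Set.mem_biUnion ((hmemS' b₁).2 (Or.inr (Or.inl rfl))) (by rwa [hclb])
      · exact Set.mem_biUnion ((hmemS' x).2 (Or.inr (Or.inr ⟨hx, hxb⟩)))
          (by rw [hclB x ⟨hx, hxb⟩]; rfl)
  · have := hst.ncard_Y
    have := Set.ncard_union_le Y B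
    rw [mul_add]
    omega
  · have h1 := hst.card_S
    have h2 := Finset.card_union_le S (insert b₁ (B \ blob)).toFinite.toFinset
    rw [← hS'] at h2
    have h3 : (insert b₁ (B \ blob)).ncard ≤ B.ncard :=
      Set.ncard_le_ncard (Set.insert_subset hb₁B Set.sdiff_subset)
    rw [Set.ncard_eq_toFinset_card _ (insert b₁ (B \ blob)).toFinite] at h3
    rw [mul_add]
    omega
  · rintro u ⟨hu, hu'⟩ v hv huv
    by_cases hvU : v ∈ U
    · have hvDB : v ∈ D ∪ B := by
        by_contra h
        exact hv ⟨hvU, h⟩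
      rcases hvDB with h | h
      · exact absurd (hclD v h u hu huv.symm) hu'
      · exact Or.inr h
    · exact Or.inl (hst.adj_U u hu v hvU huv)
  · intro v hv hvY
    by_cases hvU : v ∈ U
    · have hvD : v ∈ D := by
        by_contra h
        exact hv ⟨hvU, fun h' => h'.elim h fun h' => hvY (Or.inr h')⟩
      have hK := connSet_compIn (G := G) hvD
      have hKD : compIn G D v ⊆ D := compIn_subset
      have hKsmall : (outerBoundary G (compIn G D v) \ U).ncard ≤ p := by
        by_contra! h
        exact hno _ ⟨hKD.trans hDU, hK, h.le⟩ (hKD.trans Set.inter_subset_left)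
      refine ⟨compIn G D v, (outerBoundary G (compIn G D v) \ U) ∪ B, mem_compIn_self hvD,
        Set.disjoint_left.2 fun x hx hx' => hx'.2 (Or.inl (hKD hx)),
        Set.disjoint_union_right.2 ⟨(hst.disjoint.mono_right (hKD.trans hDU)).symm,
          hDB.mono_left hKD⟩, Set.union_subset_union_left _ ?_,
        (Set.ncard_union_le _ _).trans (Nat.add_le_add hKsmall hBcard), ?_⟩
      · rintro x ⟨⟨-, u, hu, hux⟩, hxU⟩
        exact hst.adj_U u (hDU (hKD hu)) x hxU hux
      · intro u hu w huw
        by_cases hwU : w ∈ U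
        · rcases hclD u (hKD hu) w hwU huw with h | h
          · exact Or.inl (mem_compIn_of_adj hu h huw)
          · exact Or.inr (Or.inr h)
        · exact Or.inr (Or.inl ⟨⟨fun h => hwU (hDU (hKD h)), u, hu, huw⟩, hwU⟩)
    · obtain ⟨E, N, h1, h2, h3, h4, h5, h6⟩ := hst.pieces v hvU fun h => hvY (Or.inl h)
      exact ⟨E, N, h1, h2.mono_right Set.sdiff_subset,
        Set.disjoint_union_right.2 ⟨h3, h2.mono_right hBU⟩, h4.trans Set.subset_union_left, h5, h6⟩
  · have hrep : ∀ w, ∃ y, w ∈ W → y ∈ S ∧ w ∈ cl y := by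
      intro w
      by_cases hw : w ∈ W
      · obtain ⟨y, hy, hwy⟩ := Set.mem_iUnion₂.1 (hst.cover (hWY hw))
        exact ⟨y, fun _ => ⟨hy, hwy⟩⟩
      · exact ⟨w, fun h => absurd h hw⟩
    choose g hg using hrep
    set I := hWfin.toFinset.image g with hI
    have hIcard : d ≤ I.card := by
      have h1 : hWfin.toFinset.card ≤ b * I.card := by
        refine Finset.card_le_mul_card_image _ _ fun y hy => ?_
        obtain ⟨w₀, hw₀, rfl⟩ := Finset.mem_image.1 hy
        refine le_trans ?_ (hst.ncard_cl (g w₀) (hg w₀ (by simpa using hw₀)).1)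
        rw [← Set.ncard_coe_finset]
        refine Set.ncard_le_ncard fun w hw => ?_
        simp only [Finset.coe_filter, Set.Finite.mem_toFinset, Set.mem_ofPred_eq] at hw
        exact ⟨hw.2 ▸ (hg w hw.1).2, hWY hw.1⟩
      rw [← Set.ncard_eq_toFinset_card W hWfin, hWcard, hp, mul_comm] at h1
      exact Nat.le_of_mul_le_mul_left h1 hb
    have hsub : adjPairs (clusterGraph G cl) S ∪ I.image (fun y => (b₁, y)) ⊆
        adjPairs (clusterGraph G cl') S' := by
      rintro ⟨x, y⟩ hxy
      rw [mem_adjPairs]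
      rcases Finset.mem_union.1 hxy with h | h
      · rw [mem_adjPairs] at h
        obtain ⟨⟨hx, hy⟩, hne, a, ha, c, hc, hac⟩ := h
        exact ⟨⟨(hmemS' x).2 (Or.inl hx), (hmemS' y).2 (Or.inl hy)⟩, hne, a,
          by rwa [hclS x hx], c, by rwa [hclS y hy], hac⟩
      · obtain ⟨y', hy', he⟩ := Finset.mem_image.1 h
        obtain ⟨rfl, rfl⟩ := Prod.mk.inj he
        obtain ⟨w, hw, rfl⟩ := Finset.mem_image.1 hy'
        have hw : w ∈ W := by simpa using hw
        obtain ⟨hgS, hgw⟩ := hg w hw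
        exact ⟨⟨(hmemS' _).2 (Or.inr (Or.inl rfl)), (hmemS' _).2 (Or.inl hgS)⟩,
          fun h => hb₁S ((show b₁ = g w from h).symm ▸ hgS),
          f w, by rw [hclb]; exact hfblob w hw, w, by rwa [hclS _ hgS],
          (hf w hw).2⟩
    have hdisj : Disjoint (adjPairs (clusterGraph G cl) S) (I.image (fun y => (b₁, y))) := by
      rw [Finset.disjoint_left]
      intro x hx hx'
      obtain ⟨y, -, rfl⟩ := Finset.mem_image.1 hx'
      exact hb₁S (mem_adjPairs.1 hx).1.1
    have h1 := Finset.card_le_card hsub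
    rw [Finset.card_union_of_disjoint hdisj,
      Finset.card_image_of_injective _ (fun _ _ h => (Prod.mk.inj h).2)] at h1
    have := hst.edges
    rw [add_mul, one_mul]
    omega

end reduction

/-- The vertices outside `Y` lie in pieces attached to at most `p` vertices of `Y`. -/
def HasSmallPieces {α : Type*} (G : SimpleGraph α) (Y : Set α) (p : ℕ) : Prop :=
  ∀ v ∉ Y, ∃ D N : Set α, v ∈ D ∧ Disjoint D Y ∧ N ⊆ Y ∧ N.ncard ≤ p ∧
    ∀ u ∈ D, ∀ w, G.Adj u w → w ∈ D ∪ N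

theorem PeelingStage.hasSmallPieces {α : Type*} [Finite α] {G : SimpleGraph α} {X U Y : Set α}
    {b d m p q : ℕ} {S : Finset α} {cl : α → Set α} (hst : PeelingStage G X b p q d m U Y S cl)
    (hno : ¬ ∃ F, F ⊆ U ∧ ConnSet G F ∧ p ≤ (outerBoundary G F \ U).ncard) :
    HasSmallPieces G Y (p + b) := by
  intro v hv
  by_cases hvU : v ∈ U
  · have hK := connSet_compIn (G := G) hvU
    have hKU : compIn G U v ⊆ U := compIn_subset
    refine ⟨compIn G U v, outerBoundary G (compIn G U v) \ U, mem_compIn_self hvU,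
      hst.disjoint.symm.mono_left hKU, ?_, ?_, ?_⟩
    · rintro x ⟨⟨-, u, hu, hux⟩, hxU⟩
      exact hst.adj_U u (hKU hu) x hxU hux
    · by_contra! h
      exact hno ⟨_, hKU, hK, by omega⟩
    · intro u hu w huw
      by_cases hwU : w ∈ U
      · exact Or.inl (mem_compIn_of_adj hu hwU huw)
      · exact Or.inr ⟨⟨fun h => hwU (hKU h), u, hu, huw⟩, hwU⟩
  · obtain ⟨D, N, h1, -, h3, h4, h5, h6⟩ := hst.pieces v hvU hv
    exact ⟨D, N, h1, h3, h4, h5, h6⟩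

/-- Either there is a complete minor that is cheap to separate, or the graph decomposes
into small pieces over a set of size linear in that of `X`. -/
theorem exists_clique_or_small_pieces.{u} (h b : ℕ) (hb : 1 ≤ b) : ∃ K p L : ℕ,
    ∀ (α : Type u) [Finite α] (G : SimpleGraph α) (X : Set α), X.Nonempty → HasMinimalCuts G X b →
      (∃ B : Fin h → Set α, IsCliqueModel G B ∧
        Cheap G X (⋃ i, B i) (L * (Nat.log 2 X.ncard + 1))) ∨
      ∃ Y, X ⊆ Y ∧ Y.ncard ≤ K * X.ncard ∧ HasSmallPieces G Y p := by
  obtain ⟨D, L, hD, hclique⟩ := exists_small_clique_minor.{u} h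
  set d := D * (1 + b) with hd
  set p := d * b with hp
  set q := 1 + p * (p + b) with hq
  refine ⟨1 + b, p + b, h * (L * (b + 2) * q), fun α _ G X hX hpeel => ?_⟩
  have key : ∀ m ≤ X.ncard, (∃ U Y S cl, PeelingStage G X b p q d m U Y S cl) ∨
      ∃ Y, X ⊆ Y ∧ Y.ncard ≤ (1 + b) * X.ncard ∧ HasSmallPieces G Y (p + b) := by
    intro m
    induction m with
    | zero => exact fun _ => Or.inl ⟨_, _, _, _, PeelingStage.initial hb (by omega)⟩
    | succ m ih =>
      intro hm
      rcases ih (by omega) with ⟨U, Y, S, cl, hst⟩ | hY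
      · by_cases hex : ∃ F, F ⊆ U ∧ ConnSet G F ∧ p ≤ (outerBoundary G F \ U).ncard
        · exact Or.inl (hst.step hpeel hb hp hq hex)
        · refine Or.inr ⟨Y, hst.subset, hst.ncard_Y.trans ?_, hst.hasSmallPieces hex⟩
          rw [add_mul, one_mul]
          exact Nat.add_le_add_left (Nat.mul_le_mul_left _ (by omega)) _
      · exact Or.inr hY
  refine (key _ le_rfl).imp_left ?_
  rintro ⟨U, Y, S, cl, hst⟩
  have hS : S.Nonempty := by
    obtain ⟨x, hx⟩ := hX
    obtain ⟨y, hy, -⟩ := Set.mem_iUnion₂.1 (hst.cover (hst.subset hx))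
    exact ⟨y, hy⟩
  have hScard : S.card ≤ (1 + b) * X.ncard := by
    have := hst.card_S
    rwa [add_mul, one_mul]
  obtain ⟨B, hBS, hBc, hBcard, -, hBadj⟩ := hclique α (clusterGraph G cl) S hS (by
    have := Nat.mul_le_mul_left D hScard
    have h2 := hst.edges
    rw [hd] at h2
    nlinarith)
  have hcost : ∀ i, Cheap G X (⋃ y ∈ B i, cl y) (L * (b + 2) * q * (Nat.log 2 X.ncard + 1)) := by
    intro i
    refine (cheap_biUnion (B i) cl q fun y hy => hst.cheap_cl y (hBS i hy)).mono subset_rfl ?_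
    have h1 := hBcard i
    have h2 := (Nat.log_mono_right (b := 2) hScard).trans (Nat.log_two_mul_le _ _)
    have h3 : (B i).card ≤ L * ((b + 2) * (Nat.log 2 X.ncard + 1)) :=
      h1.trans (Nat.mul_le_mul_left _ (by nlinarith))
    calc (B i).card * q ≤ L * ((b + 2) * (Nat.log 2 X.ncard + 1)) * q := Nat.mul_le_mul_right _ h3
      _ = _ := by ring
  refine ⟨fun i => ⋃ y ∈ B i, cl y, ⟨fun i => ?_, fun i j hij => ⟨?_, ?_⟩⟩, ?_⟩
  · exact (hBc i).biUnion_cluster fun y hy => hst.connSet_cl y (hBS i hy)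
  · simp only [Set.disjoint_iUnion_left, Set.disjoint_iUnion_right]
    intro y hy z hz
    refine hst.pairwise_cl z (hBS i hz) y (hBS j hy) ?_
    rintro rfl
    exact Finset.disjoint_left.1 (hBadj i j hij).1 hz hy
  · obtain ⟨-, y, hy, z, hz, -, a, ha, c, hc, hac⟩ := hBadj i j hij
    exact ⟨a, Set.mem_biUnion hy ha, c, Set.mem_biUnion hz hc, hac⟩
  · have h1 := cheap_biUnion (X := X) (G := G) Finset.univ (fun i => ⋃ y ∈ B i, cl y) _
      fun i _ => hcost i
    simp only [Finset.mem_univ, Set.iUnion_true, Finset.card_univ, Fintype.card_fin] at h1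
    exact h1.mono subset_rfl (le_of_eq (by ring))

section ball
variable {α : Type*} {G : SimpleGraph α} {X Y U T : Set α}

/-- The vertices that can be joined to `T` inside `U` by a connected set that is cheap to
separate. -/
def cheapBall (G : SimpleGraph α) (X U T : Set α) (q : ℕ) : Set α :=
  {v | ∃ P ⊆ U, ConnSet G P ∧ v ∈ P ∧ (P ∩ T).Nonempty ∧ Cheap G X P q}

theorem cheapBall_mono {q q' : ℕ} (h : q ≤ q') : cheapBall G X U T q ⊆ cheapBall G X U T q' := by
  rintro v ⟨P, h1, h2, h3, h4, h5⟩
  exact ⟨P, h1, h2, h3, h4, h5.mono subset_rfl h⟩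

theorem subset_cheapBall (hT : T ⊆ U) {q : ℕ} (hq : 1 ≤ q) : T ⊆ cheapBall G X U T q :=
  fun v hv => ⟨{v}, by simpa using hT hv, ConnSet.singleton G v, rfl, ⟨v, rfl, hv⟩,
    (cheap_singleton v).mono subset_rfl hq⟩

/-- Adding to a ball the small pieces attached to it gives a set whose boundary lies in `Y` and
in a slightly larger ball. -/
theorem exists_closure_cheapBall {p q : ℕ} (hXY : X ⊆ Y) (hsp : HasSmallPieces G Y p)
    (hT : T ⊆ U) (hq : 1 ≤ q) : ∃ S, cheapBall G X U T q ⊆ S ∧ S ⊆ U ∧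
      S ∩ Y ⊆ cheapBall G X U T q ∧
      outerBoundary G S ∩ U ⊆ Y ∩ cheapBall G X U T (q + (p + 1)) := by
  refine ⟨{v | ∃ P ⊆ U, ConnSet G P ∧ v ∈ P ∧ (P ∩ T).Nonempty ∧
    P ⊆ cheapBall G X U T q ∪ Yᶜ}, ?_, ?_, ?_, ?_⟩
  · rintro v ⟨P, h1, h2, h3, h4, h5⟩
    exact ⟨P, h1, h2, h3, h4, fun w hw => Or.inl ⟨P, h1, h2, hw, h4, h5⟩⟩
  · rintro v ⟨P, h1, -, h3, -⟩
    exact h1 h3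
  · rintro v ⟨⟨P, -, -, h3, -, h5⟩, hvY⟩
    exact (h5 h3).resolve_right fun h => h hvY
  · rintro v ⟨⟨hvS, u, ⟨P, h1, h2, h3, h4, h5⟩, huv⟩, hvU⟩
    have hv : v ∉ cheapBall G X U T q ∪ Yᶜ := fun h => hvS
      ⟨insert v P, Set.insert_subset hvU h1, h2.insert_adj h3 huv, Or.inl rfl,
        h4.mono (Set.inter_subset_inter_left _ (Set.subset_insert _ _)), Set.insert_subset h h5⟩
    have hvY : v ∈ Y := by
      by_contra h
      exact hv (Or.inr h)
    refine ⟨hvY, ?_⟩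
    by_cases hu : u ∈ cheapBall G X U T q
    · obtain ⟨P', h1', h2', h3', h4', h5'⟩ := hu
      refine ⟨insert v P', Set.insert_subset hvU h1', h2'.insert_adj h3' huv, Or.inl rfl,
        h4'.mono (Set.inter_subset_inter_left _ (Set.subset_insert _ _)), ?_⟩
      rw [← Set.union_singleton]
      exact (h5'.union (cheap_singleton v)).mono subset_rfl (by omega)
    · have huY : u ∉ Y := (h5 h3).resolve_left hu
      obtain ⟨D, N, huD, hDY, hNY, hN, hD⟩ := hsp u huY
      have huDU : u ∈ D ∩ U := ⟨huD, h1 h3⟩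
      set Q := compIn G (D ∩ U) u with hQ
      have hQsub : Q ⊆ D ∩ U := compIn_subset
      have hQc : ConnSet G Q := connSet_compIn huDU
      have huQ : u ∈ Q := mem_compIn_self huDU
      obtain ⟨w, hwQ, x, hx, hwx⟩ : ∃ w ∈ Q, ∃ x ∈ cheapBall G X U T q, w = x ∨ G.Adj w x := by
        by_contra! hno
        have hPQ : P ⊆ Q := h2.subset_of_closed h3 huQ fun w hw hwQ x hx hwx => by
          rcases h5 hx with hxB | hxY
          · exact absurd hwx (hno w hwQ x hxB).2
          · refine mem_compIn_of_adj hwQ ⟨?_, h1 hx⟩ hwx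
            exact (hD w (hQsub hwQ).1 x hwx).resolve_right fun h => hxY (hNY h)
        obtain ⟨t, htP, htT⟩ := h4
        exact (hno t (hPQ htP) t (subset_cheapBall hT hq htT)).1 rfl
      obtain ⟨P', h1', h2', h3', h4', h5'⟩ := hx
      have hconn : ConnSet G (P' ∪ Q) := by
        rcases hwx with rfl | hwx
        · exact h2'.union hQc ⟨w, h3', hwQ⟩
        · exact h2'.union_adj hQc h3' hwQ hwx.symm
      have hcheap : Cheap G X (insert v Q) (p + 1) := by
        refine ⟨insert v N, D, ?_, ?_, hDY.mono_right hXY, ?_⟩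
        · exact Set.insert_subset (Or.inl (Or.inl rfl)) fun y hy => Or.inr (hQsub hy).1
        · exact (Set.ncard_insert_le _ _).trans (by omega)
        · intro y hy z hyz
          rcases hD y hy z hyz with h | h
          · exact Or.inr h
          · exact Or.inl (Or.inr h)
      refine ⟨insert v (P' ∪ Q),
        Set.insert_subset hvU (Set.union_subset h1' fun y hy => (hQsub hy).2),
        hconn.insert_adj (Or.inr huQ) huv, Or.inl rfl,
        h4'.mono fun y hy => ⟨Or.inr (Or.inl hy.1), hy.2⟩, ?_⟩
      rw [← Set.union_insert]
      exact h5'.union hcheap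

/-- A sequence growing by a factor `1 + 1 / ℓ` exceeds `N` after `O(ℓ log N)` steps. -/
theorem exists_lt_of_growth {ℓ N : ℕ} (hℓ : 1 ≤ ℓ) (a : ℕ → ℕ) (hmono : Monotone a)
    (hN : ∀ i, a i ≤ N) : ∃ i < ℓ * (Nat.log 2 N + 2), ℓ * a (i + 1) ≤ (ℓ + 1) * a i := by
  by_contra! hgrow
  have step : ∀ i, i + ℓ ≤ ℓ * (Nat.log 2 N + 2) → 2 * a i + 1 ≤ a (i + ℓ) := by
    intro i hi
    have : ∀ j ≤ ℓ, ℓ * a i + j * (a i + 1) ≤ ℓ * a (i + j) := by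
      intro j
      induction j with
      | zero => simp
      | succ j ih =>
        intro hj
        have h1 := ih (by omega)
        have h2 := hgrow (i + j) (by omega)
        have h3 := hmono (show i ≤ i + j by omega)
        rw [← add_assoc]
        nlinarith
    have := this ℓ le_rfl
    rw [← mul_add] at this
    have := Nat.le_of_mul_le_mul_left this (by omega)
    omega
  have pow : ∀ i ≤ Nat.log 2 N + 2, 2 ^ i ≤ a (ℓ * i) + 1 := by
    intro i
    induction i with
    | zero => intro; simp
    | succ i ih =>
      intro hi
      have h1 := ih (by omega)
      have h2 := step (ℓ * i) (by
        calc ℓ * i + ℓ = ℓ * (i + 1) := by ring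
          _ ≤ _ := Nat.mul_le_mul_left _ hi)
      rw [show ℓ * (i + 1) = ℓ * i + ℓ by ring, pow_succ]
      omega
  have h1 := pow _ le_rfl
  have h2 := Nat.lt_pow_succ_log_self (b := 2) (by norm_num) N
  have h3 := hN (ℓ * (Nat.log 2 N + 2))
  rw [pow_succ] at h1
  simp only [Nat.succ_eq_add_one] at h2
  omega

/-- If sets with small boundary in `U` contain most of `X`, then so do balls of
logarithmic cost. -/
theorem ncard_diff_cheapBall_lt [Finite α] {ℓ p m : ℕ} (hℓ : 1 ≤ ℓ) (hXY : X ⊆ Y)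
    (hsp : HasSmallPieces G Y p)
    (hexp : ∀ S ⊆ U, S.Nonempty → ℓ * (outerBoundary G S ∩ U).ncard ≤ (S ∩ Y).ncard →
      20 * (X \ S).ncard < m)
    (hT : T ⊆ U) (hT' : T.Nonempty) :
    20 * (X \ cheapBall G X U T (1 + ℓ * (Nat.log 2 Y.ncard + 2) * (p + 1))).ncard < m := by
  obtain ⟨i, hi, hgrow⟩ := exists_lt_of_growth hℓ
    (fun i => (cheapBall G X U T (1 + i * (p + 1)) ∩ Y).ncard)
    (fun i j hij => Set.ncard_le_ncard (Set.inter_subset_inter_left _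
      (cheapBall_mono (Nat.add_le_add_left (Nat.mul_le_mul_right _ hij) _))))
    (fun i => Set.ncard_le_ncard Set.inter_subset_right)
  obtain ⟨S, h1, h2, h3, h4⟩ := exists_closure_cheapBall (q := 1 + i * (p + 1)) hXY hsp hT
    (by omega)
  have hS := hexp S h2 (hT'.mono ((subset_cheapBall hT (by omega)).trans h1)) (by
    have hsub : (outerBoundary G S ∩ U) ∪ (S ∩ Y) ⊆
        cheapBall G X U T (1 + (i + 1) * (p + 1)) ∩ Y := by
      have he : 1 + (i + 1) * (p + 1) = 1 + i * (p + 1) + (p + 1) := by ring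
      rw [he]
      rintro v (hv | hv)
      · exact (h4 hv).symm
      · exact ⟨cheapBall_mono (by omega) (h3 hv), hv.2⟩
    have hdisj : Disjoint (outerBoundary G S ∩ U) (S ∩ Y) := by
      rw [Set.disjoint_left]
      exact fun v hv hv' => hv.1.1 hv'.1
    have h5 := Set.ncard_le_ncard hsub
    rw [Set.ncard_union_eq hdisj] at h5
    have h6 : S ∩ Y = cheapBall G X U T (1 + i * (p + 1)) ∩ Y :=
      Set.Subset.antisymm (fun v hv => ⟨h3 hv, hv.2⟩) (Set.inter_subset_inter_left _ h1)
    rw [← h6] at hgrow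
    nlinarith)
  refine lt_of_le_of_lt (Nat.mul_le_mul_left _ (Set.ncard_le_ncard ?_)) hS
  rintro x ⟨hx, hxB⟩
  refine ⟨hx, fun hxS => hxB (cheapBall_mono ?_ (h3 ⟨hxS, hXY hx⟩))⟩
  exact Nat.add_le_add_left (Nat.mul_le_mul_right _ hi.le) _

end ball

/-- A balanced separation of `X` of order at most `r`, up to a part `D` avoiding `X`. -/
def HasBalancedSeparation {α : Type*} (G : SimpleGraph α) (X : Set α) (r : ℕ) : Prop :=
  ∃ R A B D : Set α, R ∪ A ∪ B ∪ D = Set.univ ∧ Disjoint A B ∧ (∀ a ∈ A, ∀ b ∈ B, ¬ G.Adj a b) ∧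
    (∀ u ∈ D, ∀ v, G.Adj u v → v ∈ D ∪ R) ∧ Disjoint D X ∧ R.ncard ≤ r ∧
    X.ncard ≤ 20 * (A ∩ X).ncard ∧ X.ncard ≤ 20 * (B ∩ X).ncard

/-- A family of at most `h` cheap, pairwise adjacent connected sets together with a set `A` with
few neighbours outside of them. -/
structure IsPartialClique {α : Type*} (G : SimpleGraph α) (X Y : Set α) (ℓ s h : ℕ) (A : Set α)
    (M : Finset (Set α)) : Prop where
  card_le : M.card ≤ h
  connSet : ∀ P ∈ M, ConnSet G P
  cheap : ∀ P ∈ M, Cheap G X P s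
  adj : ∀ P ∈ M, ∀ Q ∈ M, P ≠ Q → Disjoint P Q ∧ ∃ a ∈ P, ∃ b ∈ Q, G.Adj a b
  disjoint : ∀ P ∈ M, Disjoint A P
  boundary : ℓ * (outerBoundary G A \ ⋃ P ∈ M, P).ncard ≤ (A ∩ Y).ncard
  half : 2 * (A ∩ X).ncard ≤ X.ncard

namespace IsPartialClique
variable {α : Type*} [Finite α] {G : SimpleGraph α} {X Y A : Set α} {ℓ s h : ℕ}
  {M : Finset (Set α)}

/-- Sets whose neighbours outside a cheap family are few cut off either few or nearly all vertices
of `X`. -/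
theorem ncard_inter_lt_or (hP : IsPartialClique G X Y ℓ s h A M) (hℓ : 1 ≤ ℓ) {r : ℕ}
    (hr : Y.ncard / ℓ + h * s ≤ r) (hX : 20 * r ≤ X.ncard) (hsep : ¬ HasBalancedSeparation G X r)
    {A' : Set α} (hA' : ℓ * (outerBoundary G A' \ ⋃ P ∈ M, P).ncard ≤ (A' ∩ Y).ncard) :
    20 * (A' ∩ X).ncard < X.ncard ∨ 10 * (X \ A').ncard < X.ncard := by
  obtain ⟨S, D, h1, h2, h3, h4⟩ := cheap_biUnion M (fun P => P) s hP.cheap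
  replace h2 : S.ncard ≤ h * s := h2.trans (Nat.mul_le_mul_right _ hP.card_le)
  set R := (outerBoundary G A' \ ⋃ P ∈ M, P) ∪ S with hR
  have hRr : R.ncard ≤ r := by
    refine (Set.ncard_union_le _ _).trans (le_trans (Nat.add_le_add ?_ h2) hr)
    rw [Nat.le_div_iff_mul_le (by omega), mul_comm]
    exact hA'.trans (Set.ncard_le_ncard Set.inter_subset_right)
  by_contra! hcon
  refine hsep ⟨R, A', (A' ∪ R ∪ D)ᶜ, D, ?_, ?_, ?_, ?_, h3, hRr, hcon.1, ?_⟩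
  · ext v
    simp only [Set.mem_union, Set.mem_compl_iff, Set.mem_univ, iff_true]
    tauto
  · rw [Set.disjoint_left]
    exact fun v hv hv' => hv' (Or.inl (Or.inl hv))
  · intro a ha b hb hab
    have hbA : b ∉ A' := fun h => hb (Or.inl (Or.inl h))
    by_cases hbM : b ∈ ⋃ P ∈ M, P
    · rcases h1 hbM with h | h
      · exact hb (Or.inl (Or.inr (Or.inr h)))
      · exact hb (Or.inr h)
    · exact hb (Or.inl (Or.inr (Or.inl ⟨⟨hbA, a, ha, hab⟩, hbM⟩)))
  · intro u hu v huv
    rcases h4 u hu v huv with h | h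
    · exact Or.inr (Or.inr h)
    · exact Or.inl h
  · have hsub : X \ A' ⊆ ((A' ∪ R ∪ D)ᶜ ∩ X) ∪ R := by
      rintro x ⟨hx, hxA⟩
      by_cases hxR : x ∈ R
      · exact Or.inr hxR
      · refine Or.inl ⟨?_, hx⟩
        rintro ((h | h) | h)
        · exact hxA h
        · exact hxR h
        · exact Set.disjoint_left.1 h3 h hx
    have := (Set.ncard_le_ncard hsub).trans (Set.ncard_union_le _ _)
    omega

theorem ncard_family_inter_le (hP : IsPartialClique G X Y ℓ s h A M) :
    ((⋃ P ∈ M, P) ∩ X).ncard ≤ h * s := by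
  obtain ⟨S, D, h1, h2, h3, h4⟩ := cheap_biUnion M (fun P => P) s hP.cheap
  refine (Set.ncard_le_ncard ?_).trans (h2.trans (Nat.mul_le_mul_right _ hP.card_le))
  rintro x ⟨hx, hxX⟩
  exact (h1 hx).resolve_right fun h => Set.disjoint_left.1 h3 h hxX

/-- A family of fewer than `h` sets can be extended, or `A` enlarged. -/
theorem exists_larger (hP : IsPartialClique G X Y ℓ s h A M) (hℓ : 1 ≤ ℓ) {r p : ℕ}
    (hr : Y.ncard / ℓ + h * s ≤ r) (hX : 20 * r ≤ X.ncard) (hX0 : X.Nonempty)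
    (hsep : ¬ HasBalancedSeparation G X r) (hXY : X ⊆ Y) (hsp : HasSmallPieces G Y p)
    (hs : 1 + h * (2 * (1 + ℓ * (Nat.log 2 Y.ncard + 2) * (p + 1))) ≤ s) (hM : M.card < h) :
    ∃ A' M', IsPartialClique G X Y ℓ s h A' M' ∧
      (h + 1) * A.ncard + M.card < (h + 1) * A'.ncard + M'.card := by
  classical
  have hX1 : 0 < X.ncard := (Set.ncard_pos).2 hX0
  set MM := ⋃ P ∈ M, P with hMM
  have hmemMM : ∀ v, v ∈ MM ↔ ∃ P ∈ M, v ∈ P := fun v => by simp [hMM]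
  have hAX : 20 * (A ∩ X).ncard < X.ncard := by
    refine (hP.ncard_inter_lt_or hℓ hr hX hsep hP.boundary).resolve_right fun h => ?_
    have h1 := Set.ncard_inter_add_ncard_sdiff_eq_ncard X A
    rw [Set.inter_comm] at h1
    have := hP.half
    omega
  have hMX : (MM ∩ X).ncard ≤ h * s := hP.ncard_family_inter_le
  have hbd : (outerBoundary G A \ MM).ncard ≤ Y.ncard / ℓ := by
    rw [Nat.le_div_iff_mul_le (by omega), mul_comm]
    exact hP.boundary.trans (Set.ncard_le_ncard Set.inter_subset_right)
  set U := (MM ∪ A ∪ outerBoundary G A)ᶜ with hU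
  have hUM : ∀ v ∈ U, v ∉ MM := fun v hv h => hv (Or.inl (Or.inl h))
  have hUA : ∀ v ∈ U, v ∉ A := fun v hv h => hv (Or.inl (Or.inr h))
  have hUne : U.Nonempty := by
    by_contra hne
    have hsub : X ⊆ (MM ∩ X) ∪ (A ∩ X) ∪ (outerBoundary G A \ MM) := by
      intro x hx
      by_contra hcon
      refine hne ⟨x, ?_⟩
      rintro ((h | h) | h)
      · exact hcon (Or.inl (Or.inl ⟨h, hx⟩))
      · exact hcon (Or.inl (Or.inr ⟨h, hx⟩))
      · by_cases hxM : x ∈ MM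
        · exact hcon (Or.inl (Or.inl ⟨hxM, hx⟩))
        · exact hcon (Or.inr ⟨h, hxM⟩)
    have h1 := (Set.ncard_le_ncard hsub).trans ((Set.ncard_union_le _ _).trans
      (Nat.add_le_add_right (Set.ncard_union_le _ _) _))
    omega
  by_contra! hmax
  have hnb : ∀ P ∈ M, (outerBoundary G P ∩ U).Nonempty := by
    intro P hPM
    by_contra hne
    have hdisj : Disjoint A P := hP.disjoint P hPM
    have hconf : IsPartialClique G X Y ℓ s h (A ∪ P) (M.erase P) := by
      refine ⟨(Finset.card_erase_le).trans hP.card_le,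
        fun Q hQ => hP.connSet Q (Finset.mem_of_mem_erase hQ),
        fun Q hQ => hP.cheap Q (Finset.mem_of_mem_erase hQ),
        fun Q hQ Q' hQ' => hP.adj Q (Finset.mem_of_mem_erase hQ) Q' (Finset.mem_of_mem_erase hQ'),
        fun Q hQ => ?_, ?_, ?_⟩
      · exact Set.disjoint_union_left.2 ⟨hP.disjoint Q (Finset.mem_of_mem_erase hQ),
          (hP.adj P hPM Q (Finset.mem_of_mem_erase hQ) (Finset.ne_of_mem_erase hQ).symm).1⟩
      · have hsub : outerBoundary G (A ∪ P) \ ⋃ Q ∈ M.erase P, Q ⊆ outerBoundary G A \ MM := by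
          rintro v ⟨⟨hvAP, u, hu, huv⟩, hvM⟩
          have hvM' : v ∉ MM := by
            rw [hmemMM]
            rintro ⟨Q, hQ, hvQ⟩
            rcases eq_or_ne Q P with rfl | hQP
            · exact hvAP (Or.inr hvQ)
            · exact hvM (Set.mem_biUnion (Finset.mem_erase.2 ⟨hQP, hQ⟩) hvQ)
          have hvA : v ∉ A := fun h => hvAP (Or.inl h)
          refine ⟨?_, hvM'⟩
          rcases hu with hu | hu
          · exact ⟨hvA, u, hu, huv⟩
          · by_contra hvb
            refine hne ⟨v, ⟨fun h => hvAP (Or.inr h), u, hu, huv⟩, ?_⟩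
            rintro ((h | h) | h)
            · exact hvM' h
            · exact hvA h
            · exact hvb h
        refine (Nat.mul_le_mul_left _ (Set.ncard_le_ncard hsub)).trans (hP.boundary.trans ?_)
        exact Set.ncard_le_ncard (Set.inter_subset_inter_left _ Set.subset_union_left)
      · have hsub : (A ∪ P) ∩ X ⊆ (A ∩ X) ∪ (MM ∩ X) := by
          rintro x ⟨hx | hx, hxX⟩
          · exact Or.inl ⟨hx, hxX⟩
          · exact Or.inr ⟨(hmemMM x).2 ⟨P, hPM, hx⟩, hxX⟩
        have := (Set.ncard_le_ncard hsub).trans (Set.ncard_union_le _ _)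
        omega
    have h1 := hmax _ _ hconf
    rw [Set.ncard_union_eq hdisj] at h1
    have h2 := (Set.ncard_pos).2 (hP.connSet P hPM).nonempty
    have h3 := Finset.card_erase_add_one hPM
    nlinarith
  have hexp : ∀ S ⊆ U, S.Nonempty → ℓ * (outerBoundary G S ∩ U).ncard ≤ (S ∩ Y).ncard →
      20 * (X \ S).ncard < 3 * X.ncard := by
    intro S hSU hSne hS
    have hdisj : Disjoint A S := by
      rw [Set.disjoint_left]
      exact fun v hv hv' => hUA v (hSU hv') hv
    have hbdy : ℓ * (outerBoundary G (A ∪ S) \ MM).ncard ≤ ((A ∪ S) ∩ Y).ncard := by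
      have hsub : outerBoundary G (A ∪ S) \ MM ⊆
          (outerBoundary G A \ MM) ∪ (outerBoundary G S ∩ U) := by
        rintro v ⟨⟨hvAS, u, hu, huv⟩, hvM⟩
        by_cases hvb : v ∈ outerBoundary G A
        · exact Or.inl ⟨hvb, hvM⟩
        · refine Or.inr ⟨⟨fun h => hvAS (Or.inr h), u, ?_, huv⟩, ?_⟩
          · exact hu.resolve_left fun h => hvb ⟨fun h => hvAS (Or.inl h), u, h, huv⟩
          · rintro ((h | h) | h)
            · exact hvM h
            · exact hvAS (Or.inl h)
            · exact hvb h
      have h1 := (Set.ncard_le_ncard hsub).trans (Set.ncard_union_le _ _)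
      have h2 : ((A ∪ S) ∩ Y).ncard = (A ∩ Y).ncard + (S ∩ Y).ncard := by
        rw [Set.union_inter_distrib_right]
        exact Set.ncard_union_eq (hdisj.mono Set.inter_subset_left Set.inter_subset_left)
      have h3 := hP.boundary
      rw [h2]
      nlinarith
    rcases hP.ncard_inter_lt_or hℓ hr hX hsep hbdy with h | h
    · exfalso
      have h1 := hmax (A ∪ S) M ⟨hP.card_le, hP.connSet, hP.cheap, hP.adj, fun P hPM => ?_, hbdy,
        by omega⟩
      · rw [Set.ncard_union_eq hdisj] at h1
        have h2 := (Set.ncard_pos).2 hSne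
        nlinarith
      · refine Set.disjoint_union_left.2 ⟨hP.disjoint P hPM, ?_⟩
        rw [Set.disjoint_left]
        exact fun v hv hv' => hUM v (hSU hv) ((hmemMM v).2 ⟨P, hPM, hv'⟩)
    · have hsub : X \ S ⊆ (X \ (A ∪ S)) ∪ (A ∩ X) := by
        rintro x ⟨hx, hxS⟩
        by_cases hxA : x ∈ A
        · exact Or.inr ⟨hxA, hx⟩
        · exact Or.inl ⟨hx, fun h => h.elim hxA hxS⟩
      have := (Set.ncard_le_ncard hsub).trans (Set.ncard_union_le _ _)
      omega
  obtain ⟨v₀, hv₀⟩ := hUne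
  set q := 1 + ℓ * (Nat.log 2 Y.ncard + 2) * (p + 1) with hq
  have hball₀ : 20 * (X \ cheapBall G X U {v₀} q).ncard < 3 * X.ncard :=
    ncard_diff_cheapBall_lt hℓ hXY hsp hexp (T := {v₀}) (by simpa using hv₀) (by simp)
  have hjoin : ∀ P ∈ M, ∃ Z ⊆ U, ConnSet G Z ∧ v₀ ∈ Z ∧ (∃ a ∈ Z, ∃ b ∈ P, G.Adj a b) ∧
      Cheap G X Z (2 * q) := by
    intro P hPM
    have hball : 20 * (X \ cheapBall G X U (outerBoundary G P ∩ U) q).ncard < 3 * X.ncard :=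
      ncard_diff_cheapBall_lt hℓ hXY hsp hexp Set.inter_subset_right (hnb P hPM)
    obtain ⟨x, hx₀, hx⟩ : ∃ x, x ∈ cheapBall G X U {v₀} q ∧
        x ∈ cheapBall G X U (outerBoundary G P ∩ U) q := by
      by_contra! hno
      have hsub : X ⊆ (X \ cheapBall G X U {v₀} q) ∪
          (X \ cheapBall G X U (outerBoundary G P ∩ U) q) := by
        intro x hx
        by_cases hx₀ : x ∈ cheapBall G X U {v₀} q
        · exact Or.inr ⟨hx, hno x hx₀⟩
        · exact Or.inl ⟨hx, hx₀⟩
      have := (Set.ncard_le_ncard hsub).trans (Set.ncard_union_le _ _)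
      omega
    obtain ⟨Q, h1, h2, h3, ⟨_, h4, rfl⟩, h5⟩ := hx₀
    obtain ⟨Q', h1', h2', h3', ⟨a, ha, ⟨-, b, hb, hab⟩, -⟩, h5'⟩ := hx
    exact ⟨Q ∪ Q', Set.union_subset h1 h1', h2.union h2' ⟨x, h3, h3'⟩, Or.inl h4,
      ⟨a, Or.inr ha, b, hb, hab.symm⟩, (h5.union h5').mono subset_rfl (by omega)⟩
  choose! Z hZU hZc hZv hZadj hZcheap using hjoin
  set W := {v₀} ∪ ⋃ P ∈ M, Z P with hW
  have hWU : W ⊆ U := Set.union_subset (by simpa using hv₀) (Set.iUnion₂_subset hZU)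
  have hWdisj : ∀ P ∈ M, Disjoint W P := fun P hPM => by
    rw [Set.disjoint_left]
    exact fun v hv hv' => hUM v (hWU hv) ((hmemMM v).2 ⟨P, hPM, hv'⟩)
  have hWadj : ∀ P ∈ M, ∃ a ∈ W, ∃ b ∈ P, G.Adj a b := fun P hPM => by
    obtain ⟨a, ha, b, hb, hab⟩ := hZadj P hPM
    exact ⟨a, Or.inr (Set.mem_biUnion hPM ha), b, hb, hab⟩
  have hWM : W ∉ M := fun hWM =>
    have h : v₀ ∈ W := Or.inl rfl
    Set.disjoint_left.1 (hWdisj W hWM) h h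
  have hWc : ConnSet G W := by
    have hWeq : W = {v₀} ∪ ⋃ P : M, Z P.1 := by
      rw [hW]
      ext
      simp
    rw [hWeq]
    refine (ConnSet.singleton G v₀).union_iUnion fun P => ?_
    rw [Set.union_eq_self_of_subset_left (by simpa using hZv P.1 P.2)]
    exact hZc P.1 P.2
  have hWcheap : Cheap G X W s := by
    refine ((cheap_singleton v₀).union (cheap_biUnion M Z _ hZcheap)).mono subset_rfl ?_
    exact le_trans (Nat.add_le_add_left (Nat.mul_le_mul_right _ hP.card_le) _) hs
  have hconf : IsPartialClique G X Y ℓ s h A (insert W M) := by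
    refine ⟨by rw [Finset.card_insert_of_notMem hWM]; omega, ?_, ?_, ?_, ?_, ?_, hP.half⟩
    · exact fun P hPM => (Finset.mem_insert.1 hPM).elim (fun h => h ▸ hWc) (hP.connSet P)
    · exact fun P hPM => (Finset.mem_insert.1 hPM).elim (fun h => h ▸ hWcheap) (hP.cheap P)
    · intro P hPM Q hQM hne
      rcases Finset.mem_insert.1 hPM with rfl | hPM <;>
      rcases Finset.mem_insert.1 hQM with rfl | hQM
      · exact absurd rfl hne
      · exact ⟨hWdisj Q hQM, hWadj Q hQM⟩
      · obtain ⟨a, ha, b, hb, hab⟩ := hWadj P hPM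
        exact ⟨(hWdisj P hPM).symm, b, hb, a, ha, hab.symm⟩
      · exact hP.adj P hPM Q hQM hne
    · intro P hPM
      rcases Finset.mem_insert.1 hPM with rfl | hPM
      · rw [Set.disjoint_left]
        exact fun v hv hv' => hUA v (hWU hv') hv
      · exact hP.disjoint P hPM
    · refine (Nat.mul_le_mul_left _ (Set.ncard_le_ncard ?_)).trans hP.boundary
      refine Set.sdiff_subset_sdiff_right ?_
      rw [Finset.set_biUnion_insert]
      exact Set.subset_union_right
  have h1 := hmax _ _ hconf
  rw [Finset.card_insert_of_notMem hWM] at h1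
  omega

end IsPartialClique

/-- A graph decomposing into small pieces over `Y` has a balanced separation or a complete minor
that is cheap to separate. -/
theorem exists_clique_or_balancedSeparation {α : Type*} [Finite α] {G : SimpleGraph α} {X Y : Set α}
    {ℓ s h p r : ℕ} (hℓ : 1 ≤ ℓ) (hr : Y.ncard / ℓ + h * s ≤ r) (hX : 20 * r ≤ X.ncard)
    (hX0 : X.Nonempty) (hXY : X ⊆ Y) (hsp : HasSmallPieces G Y p)
    (hs : 1 + h * (2 * (1 + ℓ * (Nat.log 2 Y.ncard + 2) * (p + 1))) ≤ s) :
    (∃ B : Fin h → Set α, IsCliqueModel G B ∧ Cheap G X (⋃ i, B i) (h * s)) ∨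
      HasBalancedSeparation G X r := by
  by_contra! hcon
  have hfin : (Set.univ : Set (Set α × Finset (Set α))).Finite := Set.toFinite _
  obtain ⟨⟨A, M⟩, hP, hmax⟩ := Set.exists_max_image
    {c : Set α × Finset (Set α) | IsPartialClique G X Y ℓ s h c.1 c.2}
    (fun c => (h + 1) * c.1.ncard + c.2.card) (hfin.subset (Set.subset_univ _))
    ⟨(∅, ∅), by constructor <;> simp [outerBoundary]⟩
  replace hP : IsPartialClique G X Y ℓ s h A M := hP
  rcases lt_or_eq_of_le hP.card_le with hlt | heq
  · obtain ⟨A', M', h1, h2⟩ := hP.exists_larger hℓ hr hX hX0 hcon.2 hXY hsp hs hlt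
    exact absurd (hmax (A', M') h1) (by simpa using h2)
  · let e := (Finset.equivFinOfCardEq heq).symm
    refine hcon.1 (fun i => (e i).1) ⟨fun i => hP.connSet _ (e i).2, fun i j hij =>
      hP.adj _ (e i).2 _ (e j).2 fun h => hij (e.injective (Subtype.ext h))⟩ ?_
    refine (cheap_biUnion M (fun P => P) s hP.cheap).mono ?_ (by rw [heq])
    exact Set.iUnion_subset fun i => Set.subset_biUnion_of_mem (u := fun P => P) (e i).2

theorem Nat.mul_log_two_add_one_le {a F : ℕ} (h : 2 ^ (4 * a) ≤ F) :
    a * (Nat.log 2 F + 1) ≤ F := by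
  have hF : F ≠ 0 := by
    rintro rfl
    simp at h
  have h1 : 4 * a ≤ Nat.log 2 F := Nat.le_log_of_pow_le (by norm_num) h
  refine le_trans ?_ (Nat.pow_log_le_self 2 hF)
  generalize Nat.log 2 F = m at h1
  have h2 : m / 2 + 1 ≤ 2 ^ (m / 2) := Nat.lt_two_pow_self
  calc a * (m + 1) ≤ (m / 2 + 1) * (m / 2 + 1) := by
        have h3 : 2 * a ≤ m / 2 + 1 := by omega
        have h4 : m + 1 ≤ 2 * (m / 2 + 1) := by omega
        nlinarith
    _ ≤ 2 ^ (m / 2) * 2 ^ (m / 2) := Nat.mul_le_mul h2 h2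
    _ = 2 ^ (m / 2 + m / 2) := (pow_add _ _ _).symm
    _ ≤ 2 ^ m := Nat.pow_le_pow_right (by norm_num) (by omega)

/-- If `G - X` has minimal cuts, then there is a complete minor that can be separated from `X` by
logarithmically many vertices, or a balanced separation of `X` of small linear order. -/
theorem exists_cheap_clique_or_balancedSeparation.{u} (h b n : ℕ) (hb : 1 ≤ b) : ∃ L F₀ : ℕ,
    ∀ (α : Type u) [Finite α] (G : SimpleGraph α) (X : Set α), F₀ ≤ X.ncard → HasMinimalCuts G X b →
      (∃ B : Fin h → Set α, IsCliqueModel G B ∧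
        Cheap G X (⋃ i, B i) (L * (Nat.log 2 X.ncard + 1))) ∨
      ∃ r, n * r ≤ X.ncard ∧ HasBalancedSeparation G X r := by
  obtain ⟨K, p, L, hKpL⟩ := exists_clique_or_small_pieces.{u} h b hb
  set m := n + 20 with hm
  set ℓ := 2 * (K + 1) * m with hℓ
  set c := 1 + h * (2 * (1 + ℓ * (K + 2) * (p + 1))) with hc
  refine ⟨L + h * c, 2 ^ (4 * (2 * m * (h * c))), fun α _ G X hF hpeel => ?_⟩
  have hX : X.Nonempty := by
    rw [← Set.ncard_pos]
    exact lt_of_lt_of_le (by positivity) hF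
  rcases hKpL α G X hX hpeel with ⟨B, hB, hcheap⟩ | ⟨Y, hXY, hY, hsp⟩
  · exact Or.inl ⟨B, hB, hcheap.mono subset_rfl (Nat.mul_le_mul_right _ (by omega))⟩
  set t := Nat.log 2 X.ncard with ht
  have hlog : Nat.log 2 Y.ncard + 2 ≤ (K + 2) * (t + 1) := by
    have := (Nat.log_mono_right (b := 2) hY).trans (Nat.log_two_mul_le _ _)
    nlinarith
  have hs : 1 + h * (2 * (1 + ℓ * (Nat.log 2 Y.ncard + 2) * (p + 1))) ≤ c * (t + 1) := by
    have h1 : ℓ * (Nat.log 2 Y.ncard + 2) * (p + 1) ≤ ℓ * (K + 2) * (p + 1) * (t + 1) := by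
      calc ℓ * (Nat.log 2 Y.ncard + 2) * (p + 1) ≤ ℓ * ((K + 2) * (t + 1)) * (p + 1) :=
            Nat.mul_le_mul_right _ (Nat.mul_le_mul_left _ hlog)
        _ = _ := by ring
    have h2 : 1 + ℓ * (Nat.log 2 Y.ncard + 2) * (p + 1) ≤
        (1 + ℓ * (K + 2) * (p + 1)) * (t + 1) := by nlinarith
    have h3 := Nat.mul_le_mul_left (h * 2) h2
    rw [hc]
    nlinarith
  have hdiv : 2 * m * (Y.ncard / ℓ) ≤ X.ncard := by
    have h1 := Nat.div_mul_le_self Y.ncard ℓ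
    have h2 : (K + 1) * (2 * m * (Y.ncard / ℓ)) ≤ (K + 1) * X.ncard := by
      calc (K + 1) * (2 * m * (Y.ncard / ℓ)) = Y.ncard / ℓ * ℓ := by rw [hℓ]; ring
        _ ≤ K * X.ncard := h1.trans hY
        _ ≤ _ := Nat.mul_le_mul_right _ (by omega)
    exact Nat.le_of_mul_le_mul_left h2 (by omega)
  have hcost : 2 * m * (h * (c * (t + 1))) ≤ X.ncard := by
    have := Nat.mul_log_two_add_one_le hF
    calc _ = 2 * m * (h * c) * (t + 1) := by ring
      _ ≤ _ := this
  have hr : m * (Y.ncard / ℓ + h * (c * (t + 1))) ≤ X.ncard := by nlinarith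
  rcases exists_clique_or_balancedSeparation (r := Y.ncard / ℓ + h * (c * (t + 1)))
    (Nat.mul_pos (by omega) (by omega)) le_rfl
    ((Nat.mul_le_mul_right _ (by omega)).trans hr) hX hXY hsp hs
    with ⟨B, hB, hcheap⟩ | hsep
  · refine Or.inl ⟨B, hB, hcheap.mono subset_rfl ?_⟩
    rw [← mul_assoc]
    exact Nat.mul_le_mul_right _ (by omega)
  · exact Or.inr ⟨_, (Nat.mul_le_mul_right _ (by omega)).trans hr, hsep⟩

section packing
variable {α β : Type*} {H : SimpleGraph β} {G : SimpleGraph α}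

theorem hasDisjointModels_zero : HasDisjointModels H G 0 :=
  ⟨fun i => i.elim0, fun i => i.elim0, fun i => i.elim0⟩

theorem HasDisjointModels.of_injective {ι : Type*} {k : ℕ} (e : Fin k → ι)
    (he : Function.Injective e) (M : ι → β → Set α) (hM : ∀ i, IsMinorModel H G (M i))
    (hdisj : Pairwise fun i j => Disjoint (⋃ u, M i u) (⋃ u, M j u)) :
    HasDisjointModels H G k :=
  ⟨M ∘ e, fun i => hM (e i), fun _ _ hij => hdisj (he.ne hij)⟩

theorem HasDisjointModels.mono {m n : ℕ} (h : HasDisjointModels H G n) (hmn : m ≤ n) :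
    HasDisjointModels H G m := by
  obtain ⟨M, hM, hdisj⟩ := h
  exact .of_injective (Fin.castLE hmn) (Fin.castLE_injective hmn) M hM hdisj

theorem HasDisjointModels.image_val {W : Set α} {k : ℕ}
    (h : HasDisjointModels H (G.induce W) k) : ∃ M : Fin k → β → Set α,
      (∀ i, IsMinorModel H G (M i)) ∧ (Pairwise fun i j => Disjoint (⋃ u, M i u) (⋃ u, M j u)) ∧
      ∀ i, (⋃ u, M i u) ⊆ W := by
  obtain ⟨M, hM, hdisj⟩ := h
  refine ⟨fun i u => Subtype.val '' M i u, fun i => (hM i).image_val,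
    fun i j hij => ?_, fun i => ?_⟩
  · beta_reduce
    rw [← Set.image_iUnion, ← Set.image_iUnion, Set.disjoint_image_iff Subtype.val_injective]
    exact hdisj hij
  · refine Set.iUnion_subset fun u => ?_
    rintro _ ⟨x, -, rfl⟩
    exact x.2

theorem HasDisjointModels.of_induce {W : Set α} {k : ℕ}
    (h : HasDisjointModels H (G.induce W) k) : HasDisjointModels H G k := by
  obtain ⟨M, hM, hdisj, -⟩ := h.image_val
  exact ⟨M, hM, hdisj⟩

theorem HasDisjointModels.append {A B : Set α} (hAB : Disjoint A B) {m n : ℕ}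
    (hA : HasDisjointModels H (G.induce A) m) (hB : HasDisjointModels H (G.induce B) n) :
    HasDisjointModels H G (m + n) := by
  obtain ⟨M, hM, hM', hMA⟩ := hA.image_val
  obtain ⟨N, hN, hN', hNB⟩ := hB.image_val
  refine .of_injective finSumFinEquiv.symm finSumFinEquiv.symm.injective (Sum.elim M N) ?_ ?_
  · rintro (i | i)
    exacts [hM i, hN i]
  · rintro (i | i) (j | j) hij
    · exact hM' fun h => hij (congrArg _ h)
    · exact hAB.mono (hMA i) (hNB j)
    · exact (hAB.mono (hMA j) (hNB i)).symm
    · exact hN' fun h => hij (congrArg _ h)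

theorem exists_hasDisjointModels_and_not {k : ℕ} (h : ¬ HasDisjointModels H G k) :
    ∃ m, HasDisjointModels H G m ∧ ¬ HasDisjointModels H G (m + 1) := by
  induction k with
  | zero => exact absurd hasDisjointModels_zero h
  | succ k ih =>
    by_cases hk : HasDisjointModels H G k
    · exact ⟨k, hk, h⟩
    · exact ih hk

/-- Packing numbers of disjoint induced subgraphs add up to at most that of the graph. -/
theorem exists_add_le_of_not_hasDisjointModels {A B : Set α} (hAB : Disjoint A B) {k : ℕ}
    (h : ¬ HasDisjointModels H G (k + 1)) : ∃ m n, m + n ≤ k ∧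
      ¬ HasDisjointModels H (G.induce A) (m + 1) ∧ ¬ HasDisjointModels H (G.induce B) (n + 1) := by
  obtain ⟨m, hm, hm'⟩ := exists_hasDisjointModels_and_not
    (fun hA : HasDisjointModels H (G.induce A) (k + 1) => h hA.of_induce)
  obtain ⟨n, hn, hn'⟩ := exists_hasDisjointModels_and_not
    (fun hB : HasDisjointModels H (G.induce B) (k + 1) => h hB.of_induce)
  refine ⟨m, n, ?_, hm', hn'⟩
  by_contra! hlt
  exact h ((hm.append hAB hn).mono hlt)

theorem IsHittingSet.exists_mem_of_subset {W : Set α} {T : Set W}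
    (hT : IsHittingSet H (G.induce W) T) {B : β → Set α} (hB : IsMinorModel H G B)
    (hW : (⋃ u, B u) ⊆ W) : ∃ a ∈ Subtype.val '' T, ∃ u, a ∈ B u := by
  obtain ⟨a, ha, u, hu⟩ := hT _ (hB.preimage_val fun u => (Set.subset_iUnion B u).trans hW)
  exact ⟨a, ⟨a, ha, rfl⟩, u, hu⟩

theorem IsHittingSet.preimage_val {X : Set α} (hX : IsHittingSet H G X) (W : Set α) :
    IsHittingSet H (G.induce W) (Subtype.val ⁻¹' X) := by
  intro B hB
  obtain ⟨a, ha, u, x, hx, rfl⟩ := hX _ hB.image_val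
  exact ⟨x, ha, u, hx⟩

theorem ncard_preimage_val (W X : Set α) :
    (Subtype.val ⁻¹' X : Set W).ncard = (W ∩ X).ncard := by
  rw [← Set.ncard_image_of_injective _ Subtype.val_injective, Subtype.image_preimage_coe]

theorem exists_isHittingSet_of_induce_compl [Finite α] {S : Set α} {T : Set ↑Sᶜ}
    (hT : IsHittingSet H (G.induce Sᶜ) T) :
    ∃ T', IsHittingSet H G T' ∧ T'.ncard ≤ S.ncard + T.ncard := by
  refine ⟨S ∪ Subtype.val '' T, fun B hB => ?_, (Set.ncard_union_le _ _).trans ?_⟩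
  · by_cases hS : (⋃ u, B u) ⊆ Sᶜ
    · obtain ⟨a, ha, u, hu⟩ := hT.exists_mem_of_subset hB hS
      exact ⟨a, Or.inr ha, u, hu⟩
    · obtain ⟨a, ha, haS⟩ := Set.not_subset.1 hS
      obtain ⟨u, hu⟩ := Set.mem_iUnion.1 ha
      exact ⟨a, Or.inl (not_not.1 haS), u, hu⟩
  · rw [Set.ncard_image_of_injective _ Subtype.val_injective]

/-- A model avoiding `R` and meeting a hitting set disjoint from `D` avoids `D`, if `D` is closed
under adjacency up to `R`. -/
theorem IsMinorModel.disjoint_of_closed (hH : H.Connected) {X D R : Set α} {B : β → Set α}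
    (hX : IsHittingSet H G X) (hB : IsMinorModel H G B) (hDX : Disjoint D X)
    (hD : ∀ u ∈ D, ∀ v, G.Adj u v → v ∈ R ∪ D) (hR : (⋃ u, B u) ⊆ Rᶜ) :
    Disjoint (⋃ u, B u) D := by
  rw [Set.disjoint_left]
  intro x hx hxD
  have hsub : (⋃ u, B u) ⊆ D := (hB.connSet_iUnion hH).subset_of_closed hx hxD
    fun u _ huD v hv huv => (hD u huD v huv).resolve_left (hR hv)
  obtain ⟨a, haX, u, hau⟩ := hX B hB
  exact Set.disjoint_left.1 hDX (hsub (Set.mem_iUnion.2 ⟨u, hau⟩)) haX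

/-- Removing a separator of a cheap model decreases the packing number. -/
theorem exists_not_hasDisjointModels_induce_compl (hH : H.Connected) {X : Set α} {B : β → Set α}
    (hX : IsHittingSet H G X) (hB : IsMinorModel H G B) {s k : ℕ}
    (hcheap : Cheap G X (⋃ u, B u) s) (hk : ¬ HasDisjointModels H G (k + 1)) :
    ∃ S : Set α, S.ncard ≤ s ∧ ¬ HasDisjointModels H (G.induce Sᶜ) k := by
  obtain ⟨S, D, hBSD, hS, hDX, hD⟩ := hcheap
  refine ⟨S, hS, fun h => hk ?_⟩
  obtain ⟨M, hM, hM', hMS⟩ := h.image_val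
  have hdisj : ∀ i, Disjoint (⋃ u, B u) (⋃ u, M i u) := by
    intro i
    rw [Set.disjoint_left]
    intro x hx hxM
    rcases hBSD hx with h | h
    · exact hMS i hxM h
    · exact Set.disjoint_left.1 ((hM i).disjoint_of_closed hH hX hDX hD (hMS i)) hxM h
  refine .of_injective (finSuccEquiv k) (finSuccEquiv k).injective
    (fun o => o.elim B M) ?_ ?_
  · rintro (_ | i)
    exacts [hB, hM i]
  · rintro (_ | i) (_ | j) hij
    · exact absurd rfl hij
    · exact hdisj j
    · exact (hdisj i).symm
    · exact hM' fun h => hij (congrArg _ h)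

/-- A balanced separation of a hitting set reduces the problem to two disjoint subgraphs. -/
theorem HasBalancedSeparation.exists_split [Finite α] (hH : H.Connected) {X : Set α} {r : ℕ}
    (hsep : HasBalancedSeparation G X r) (hX : IsHittingSet H G X) : ∃ A B : Set α,
      Disjoint A B ∧ 20 * (A ∩ X).ncard ≤ 19 * X.ncard ∧ 20 * (B ∩ X).ncard ≤ 19 * X.ncard ∧
      ∀ (S : Set A) (T : Set B), IsHittingSet H (G.induce A) S → IsHittingSet H (G.induce B) T →
        ∃ Z, IsHittingSet H G Z ∧ Z.ncard ≤ r + S.ncard + T.ncard := by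
  obtain ⟨R, A, B, D, hcover, hAB, hno, hD, hDX, hR, hA, hB⟩ := hsep
  have hsum : (A ∩ X).ncard + (B ∩ X).ncard ≤ X.ncard := by
    rw [← Set.ncard_union_eq (hAB.mono Set.inter_subset_left Set.inter_subset_left)]
    exact Set.ncard_le_ncard (Set.union_subset Set.inter_subset_right Set.inter_subset_right)
  refine ⟨A, B, hAB, by omega, by omega, fun S T hS hT =>
    ⟨R ∪ Subtype.val '' S ∪ Subtype.val '' T, fun M hM => ?_, ?_⟩⟩
  · by_cases hMR : (⋃ u, M u) ⊆ Rᶜ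
    · have hMD := hM.disjoint_of_closed hH hX hDX
        (fun u hu v huv => (hD u hu v huv).symm) hMR
      have hc := hM.connSet_iUnion hH
      have hMAB : ∀ x ∈ ⋃ u, M u, x ∈ A ∨ x ∈ B := by
        intro x hx
        have : x ∈ R ∪ A ∪ B ∪ D := hcover ▸ Set.mem_univ x
        rcases this with ((h | h) | h) | h
        · exact absurd h (hMR hx)
        · exact Or.inl h
        · exact Or.inr h
        · exact absurd h (Set.disjoint_left.1 hMD hx)
      obtain ⟨x, hx⟩ := hc.nonempty
      rcases hMAB x hx with hxA | hxB
      · obtain ⟨a, ha, u, hu⟩ := hS.exists_mem_of_subset hM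
          (hc.subset_of_closed hx hxA fun u _ huA v hv huv =>
            (hMAB v hv).resolve_right fun hvB => hno u huA v hvB huv)
        exact ⟨a, Or.inl (Or.inr ha), u, hu⟩
      · obtain ⟨a, ha, u, hu⟩ := hT.exists_mem_of_subset hM
          (hc.subset_of_closed hx hxB fun u _ huB v hv huv =>
            (hMAB v hv).resolve_left fun hvA => hno v hvA u huB huv.symm)
        exact ⟨a, Or.inr ha, u, hu⟩
    · obtain ⟨a, ha, haR⟩ := Set.not_subset.1 hMR
      obtain ⟨u, hu⟩ := Set.mem_iUnion.1 ha
      exact ⟨a, Or.inl (Or.inl (not_not.1 haR)), u, hu⟩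
  · refine (Set.ncard_union_le _ _).trans (Nat.add_le_add
      ((Set.ncard_union_le _ _).trans (Nat.add_le_add hR ?_)) ?_) <;>
    rw [Set.ncard_image_of_injective _ Subtype.val_injective]

theorem IsCliqueModel.isMinorModel {h : ℕ} {B : Fin h → Set α} (hB : IsCliqueModel G B)
    (e : β ≃ Fin h) : IsMinorModel H G (fun u => B (e u)) :=
  isMinorModel_iff.2 ⟨fun _ => hB.1 _, fun _ _ huv => (hB.2 _ _ (e.injective.ne huv)).1,
    fun _ _ huv => (hB.2 _ _ (e.injective.ne huv.ne)).2⟩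

theorem exists_isHittingSet_forall_le (H : SimpleGraph β) (G : SimpleGraph α) (hH : Nonempty β) :
    ∃ X, IsHittingSet H G X ∧ ∀ Z, IsHittingSet H G Z → X.ncard ≤ Z.ncard := by
  classical
  have hex : ∃ n, ∃ S : Set α, IsHittingSet H G S ∧ S.ncard = n := by
    refine ⟨_, Set.univ, fun B hB => ?_, rfl⟩
    obtain ⟨u⟩ := hH
    obtain ⟨a, ha⟩ := ((isMinorModel_iff.1 hB).1 u).nonempty
    exact ⟨a, Set.mem_univ a, u, ha⟩
  obtain ⟨X, hX, hXn⟩ := Nat.find_spec hex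
  exact ⟨X, hX, fun Z hZ => hXn ▸ Nat.find_min' hex ⟨Z, hZ, rfl⟩⟩

theorem not_hasDisjointModels_of_packNumber_le [Finite α] (hH : Nonempty β) {k : ℕ}
    (h : packNumber H G ≤ k) : ¬ HasDisjointModels H G (k + 1) := by
  intro hk
  have hbdd : BddAbove {k | HasDisjointModels H G k} := by
    refine ⟨Nat.card α, ?_⟩
    rintro m ⟨M, hM, hdisj⟩
    obtain ⟨u⟩ := hH
    choose f hf using fun i => ((isMinorModel_iff.1 (hM i)).1 u).nonempty
    have hinj : Function.Injective f := by
      intro i j hij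
      by_contra hne
      exact Set.disjoint_left.1 (hdisj hne) (Set.mem_iUnion.2 ⟨u, hf i⟩)
        (Set.mem_iUnion.2 ⟨u, hij ▸ hf j⟩)
    simpa using Nat.card_le_card_of_injective f hinj
  have := (le_csSup hbdd hk).trans h
  omega

end packing

/-- Logarithmic losses are absorbed by the superlinear bound. -/
theorem exists_log_loss_absorbed {ε : ℝ} (hε : 0 < ε) (L : ℕ) : ∃ C₀ : ℝ, 0 < C₀ ∧
    ∀ C, C₀ ≤ C → ∀ k F : ℕ, C * ((k + 1 : ℕ) : ℝ) ^ (1 + ε) < F →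
      (L * (Nat.log 2 F + 1) : ℕ) + C * (k : ℝ) ^ (1 + ε) < F := by
  set δ := ε / (1 + ε) with hδ
  have hδ0 : 0 < δ := by positivity
  have hlog2 : 0 < Real.log 2 := Real.log_pos (by norm_num)
  set c : ℝ := L * (1 / (δ * Real.log 2) + 1) with hc
  have hc0 : 0 ≤ c := by positivity
  refine ⟨c ^ (1 + ε) + 1, by positivity, fun C hC k F hF => ?_⟩
  have hC0 : 0 < C := lt_of_lt_of_le (by positivity) hC
  by_contra! hle
  have hk : (0 : ℝ) < (k : ℝ) + 1 := by positivity
  push_cast at hF hle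
  have hFpos : (0 : ℝ) < F := lt_trans (by positivity) hF
  have hF1 : (1 : ℝ) ≤ F := by exact_mod_cast hFpos
  set A : ℝ := L * ((Nat.log 2 F : ℝ) + 1) with hA
  have hFA : (F : ℝ) ≤ (k + 1) * A := by
    have h1 : (k : ℝ) ^ (1 + ε) ≤ k * ((k : ℝ) + 1) ^ ε := by
      rw [Real.rpow_one_add' (by positivity) (by positivity)]
      gcongr
      linarith
    rw [Real.rpow_one_add' hk.le (by positivity)] at hF
    have h2 : ((k : ℝ) + 1) * F ≤ (k + 1) * A + k * (C * ((k + 1) * ((k : ℝ) + 1) ^ ε)) := by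
      calc ((k : ℝ) + 1) * F ≤ (k + 1) * (A + C * (k : ℝ) ^ (1 + ε)) := by gcongr
        _ ≤ (k + 1) * (A + C * (k * ((k : ℝ) + 1) ^ ε)) := by gcongr
        _ = _ := by ring
    have h3 : (k : ℝ) * (C * ((k + 1) * ((k : ℝ) + 1) ^ ε)) ≤ k * F := by gcongr
    linarith
  have hAc : A ≤ c * (F : ℝ) ^ δ := by
    have h1 : (Nat.log 2 F : ℝ) ≤ (F : ℝ) ^ δ * (1 / (δ * Real.log 2)) := by
      refine (Real.natLog_le_logb F 2).trans ?_
      rw [Real.logb, div_le_iff₀ (by exact_mod_cast hlog2)]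
      refine (Real.log_le_rpow_div hFpos.le hδ0).trans (le_of_eq ?_)
      push_cast
      field_simp
    have h2 : 1 ≤ (F : ℝ) ^ δ := Real.one_le_rpow hF1 hδ0.le
    calc A ≤ L * ((F : ℝ) ^ δ * (1 / (δ * Real.log 2)) + (F : ℝ) ^ δ) := by
          rw [hA]
          gcongr
      _ = _ := by rw [hc]; ring
  have hfin : (F : ℝ) ≤ c ^ (1 + ε) * ((k : ℝ) + 1) ^ (1 + ε) := by
    have h1 : (F : ℝ) ^ (1 + ε) ≤ ((k + 1) * (c * (F : ℝ) ^ δ)) ^ (1 + ε) :=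
      Real.rpow_le_rpow hFpos.le (hFA.trans (by gcongr)) (by positivity)
    have h2 : ((F : ℝ) ^ δ) ^ (1 + ε) = (F : ℝ) ^ ε := by
      rw [← Real.rpow_mul hFpos.le, hδ, div_mul_cancel₀ _ (by positivity)]
    rw [Real.mul_rpow hk.le (by positivity), Real.mul_rpow hc0 (by positivity), h2,
      Real.rpow_one_add' hFpos.le (by positivity)] at h1
    have h3 : 0 < (F : ℝ) ^ ε := by positivity
    nlinarith
  have : c ^ (1 + ε) * ((k : ℝ) + 1) ^ (1 + ε) ≤ C * ((k : ℝ) + 1) ^ (1 + ε) := by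
    gcongr
    linarith
  linarith

/-- Splitting along a balanced separation of small order improves on a superlinear bound. -/
theorem exists_separation_loss_absorbed {ε : ℝ} (hε : 0 < ε) : ∃ n : ℕ,
    ∀ C : ℝ, 0 < C → ∀ k₁ k₂ k F r a b : ℕ, k₂ ≤ k₁ → k₁ + k₂ ≤ k → n * r ≤ F →
      C * (k : ℝ) ^ (1 + ε) < F → 20 * a ≤ 19 * F →
      (k₁ < k → (a : ℝ) ≤ C * (k₁ : ℝ) ^ (1 + ε)) → (b : ℝ) ≤ C * (k₂ : ℝ) ^ (1 + ε) →
      r + a + b < F := by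
  set θ : ℝ := (39 / 40) ^ ε with hθ
  have hθ1 : θ < 1 := Real.rpow_lt_one (by norm_num) (by norm_num) hε
  obtain ⟨n, hn⟩ := exists_nat_gt (1 / (1 - θ))
  rw [div_lt_iff₀ (by linarith)] at hn
  refine ⟨n + 41, fun C hC k₁ k₂ k F r a b h21 hk hr hF ha hak hb => ?_⟩
  have hF0 : (0 : ℝ) < F := lt_of_le_of_lt (by positivity) hF
  have hk' : (k₁ : ℝ) + k₂ ≤ k := by exact_mod_cast hk
  have hr' : ((n : ℝ) + 41) * r ≤ F := by exact_mod_cast hr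
  have ha' : 20 * (a : ℝ) ≤ 19 * F := by exact_mod_cast ha
  have hr0 : (0 : ℝ) ≤ r := by positivity
  suffices (r : ℝ) + a + b < F by exact_mod_cast this
  rcases le_or_gt (40 * k₂) k with hsmall | hlarge
  · have h1 : (k₂ : ℝ) ^ (1 + ε) ≤ 1 / 40 * (k : ℝ) ^ (1 + ε) := by
      have h2 : (k₂ : ℝ) ≤ 1 / 40 * k := by
        have : 40 * (k₂ : ℝ) ≤ k := by exact_mod_cast hsmall
        linarith
      refine (Real.rpow_le_rpow (by positivity) h2 (by positivity)).trans ?_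
      rw [Real.mul_rpow (by norm_num) (by positivity),
        Real.rpow_one_add' (by norm_num) (by positivity)]
      have h3 : (1 / 40 : ℝ) ^ ε ≤ 1 := Real.rpow_le_one (by norm_num) (by norm_num) hε.le
      gcongr
      linarith
    have h4 : (b : ℝ) < 1 / 40 * F := by
      have := mul_le_mul_of_nonneg_left h1 hC.le
      linarith
    have h5 : 41 * (r : ℝ) ≤ F := by
      have : (0 : ℝ) ≤ n * r := by positivity
      linarith
    linarith
  · have hlarge' : (k : ℝ) < 40 * k₂ := by exact_mod_cast hlarge
    have h21' : (k₂ : ℝ) ≤ k₁ := by exact_mod_cast h21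
    have key : ∀ x : ℝ, 0 ≤ x → x ≤ 39 / 40 * k → x ^ (1 + ε) ≤ x * (θ * (k : ℝ) ^ ε) := by
      intro x hx hxk
      rw [Real.rpow_one_add' hx (by positivity), hθ,
        ← Real.mul_rpow (by norm_num) (by positivity)]
      gcongr
    have h1 := key k₁ (by positivity) (by linarith)
    have h2 := key k₂ (by positivity) (by linarith)
    have hθk : 0 ≤ θ * (k : ℝ) ^ ε := by positivity
    have h3 : C * (k₁ : ℝ) ^ (1 + ε) + C * (k₂ : ℝ) ^ (1 + ε) ≤ θ * F := by
      calc C * (k₁ : ℝ) ^ (1 + ε) + C * (k₂ : ℝ) ^ (1 + ε)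
          ≤ C * (k₁ * (θ * (k : ℝ) ^ ε)) + C * (k₂ * (θ * (k : ℝ) ^ ε)) := by gcongr
        _ = C * ((k₁ + k₂) * (θ * (k : ℝ) ^ ε)) := by ring
        _ ≤ C * (k * (θ * (k : ℝ) ^ ε)) := by gcongr
        _ = θ * (C * (k : ℝ) ^ (1 + ε)) := by
          rw [Real.rpow_one_add' (by positivity) (by positivity)]
          ring
        _ ≤ θ * F := by gcongr
    have h4 := hak (by omega)
    have h5 : (r : ℝ) < (1 - θ) * F := by
      by_contra! h6
      have h7 : (n : ℝ) * ((1 - θ) * F) ≤ n * r := by gcongr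
      nlinarith
    linarith

/-- A superlinear Erdős–Pósa bound for graphs all of whose `H`-minor-free instances have bounded
treewidth. -/
theorem exists_superlinear_erdosPosa_bound {β : Type} [Fintype β] (H : SimpleGraph β)
    (hH : H.Connected) {ε : ℝ} (hε : 0 < ε) {b : ℕ}
    (htw : ∀ (α : Type) [Finite α] (G : SimpleGraph α), ¬ HasDisjointModels H G 1 →
      treewidth G < b) :
    ∃ C : ℝ, 0 < C ∧ ∀ (k : ℕ) (α : Type) [Finite α] (G : SimpleGraph α),
      ¬ HasDisjointModels H G (k + 1) →
        ∃ S : Set α, IsHittingSet H G S ∧ (S.ncard : ℝ) ≤ C * (k : ℝ) ^ (1 + ε) := by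
  obtain ⟨n, hn⟩ := exists_separation_loss_absorbed hε
  obtain ⟨L, F₀, hstr⟩ := exists_cheap_clique_or_balancedSeparation.{0} (Fintype.card β) (b + 1) n
    (by omega)
  obtain ⟨C₀, hC₀, hlog⟩ := exists_log_loss_absorbed hε L
  refine ⟨C₀ + F₀, by positivity, fun k => ?_⟩
  set C : ℝ := C₀ + F₀ with hC
  have hCC₀ : C₀ ≤ C := by simp [hC]
  have hC0 : 0 < C := by positivity
  induction k using Nat.strong_induction_on with
  | _ k ih =>
  intro α _ G hG
  obtain ⟨X, hX, hmin⟩ := exists_isHittingSet_forall_le H G hH.nonempty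
  refine ⟨X, hX, ?_⟩
  by_contra! hF
  rcases Nat.eq_zero_or_pos k with rfl | hk
  · rw [zero_add] at hG
    have hempty : IsHittingSet H G ∅ := fun B hB =>
      absurd ⟨fun _ => B, fun _ => hB, fun i j hij => absurd (Subsingleton.elim i j) hij⟩ hG
    have := hmin ∅ hempty
    rw [Set.ncard_empty, Nat.le_zero] at this
    rw [this, Nat.cast_zero, Real.zero_rpow (by positivity)] at hF
    simp at hF
  have hFF₀ : F₀ ≤ X.ncard := by
    have h1 : (1 : ℝ) ≤ (k : ℝ) ^ (1 + ε) := Real.one_le_rpow (by exact_mod_cast hk) (by positivity)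
    have h2 : (F₀ : ℝ) ≤ C * (k : ℝ) ^ (1 + ε) := by nlinarith
    exact_mod_cast h2.trans hF.le
  have hfree : ¬ HasDisjointModels H (G.induce Xᶜ) 1 := by
    intro h
    obtain ⟨M, hM, -, hMX⟩ := h.image_val
    obtain ⟨a, ha, u, hu⟩ := hX _ (hM 0)
    exact hMX 0 (Set.mem_iUnion.2 ⟨u, hu⟩) ha
  rcases hstr α G X hFF₀ (hasMinimalCuts_of_treewidth ((htw _ _ hfree).trans (Nat.lt_succ_self b)))
    with ⟨B, hB, hcheap⟩ | ⟨r, hr, hsep⟩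
  · obtain ⟨S, hS, hGS⟩ := exists_not_hasDisjointModels_induce_compl hH hX
      (hB.isMinorModel (Fintype.equivFin β))
      (hcheap.mono (Set.iUnion_subset fun u => Set.subset_iUnion B _) le_rfl) hG
    obtain ⟨j, rfl⟩ : ∃ j, k = j + 1 := ⟨k - 1, by omega⟩
    obtain ⟨T, hT, hTcard⟩ := ih j (by omega) _ _ hGS
    obtain ⟨T', hT', hTcard'⟩ := exists_isHittingSet_of_induce_compl hT
    have h1 := hlog C hCC₀ j X.ncard hF
    have h2 : (X.ncard : ℝ) ≤ S.ncard + T.ncard := by exact_mod_cast (hmin T' hT').trans hTcard'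
    have h3 : (S.ncard : ℝ) ≤ (L * (Nat.log 2 X.ncard + 1) : ℕ) := by exact_mod_cast hS
    linarith
  · obtain ⟨A, B, hAB, hA, hB, hsplit⟩ := hsep.exists_split hH hX
    obtain ⟨k₁, k₂, hk₁₂, hkA, hkB⟩ := exists_add_le_of_not_hasDisjointModels hAB hG
    obtain ⟨S, hS, hSmin⟩ := exists_isHittingSet_forall_le H (G.induce A) hH.nonempty
    obtain ⟨T, hT, hTmin⟩ := exists_isHittingSet_forall_le H (G.induce B) hH.nonempty
    obtain ⟨Z, hZ, hZcard⟩ := hsplit S T hS hT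
    have hZX := hmin Z hZ
    have hSA := hSmin _ (hX.preimage_val A)
    have hTB := hTmin _ (hX.preimage_val B)
    rw [ncard_preimage_val] at hSA hTB
    have hSk : k₁ < k → (S.ncard : ℝ) ≤ C * (k₁ : ℝ) ^ (1 + ε) := fun hlt => by
      obtain ⟨S', hS', hS'card⟩ := ih k₁ hlt _ _ hkA
      exact le_trans (by exact_mod_cast hSmin S' hS') hS'card
    have hTk : k₂ < k → (T.ncard : ℝ) ≤ C * (k₂ : ℝ) ^ (1 + ε) := fun hlt => by
      obtain ⟨T', hT', hT'card⟩ := ih k₂ hlt _ _ hkB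
      exact le_trans (by exact_mod_cast hTmin T' hT') hT'card
    rcases le_total k₂ k₁ with h21 | h12
    · have := hn C hC0 k₁ k₂ k X.ncard r S.ncard T.ncard h21 hk₁₂ hr hF (by omega) hSk
        (hTk (by omega))
      omega
    · have := hn C hC0 k₂ k₁ k X.ncard r T.ncard S.ncard h12 (by omega) hr hF (by omega) hTk
        (hSk (by omega))
      omega

/-- Let `H` be a connected planar graph, `ε > 0`, and
`g : ℕ → ℕ` with `g(n) = Ω(n^{1+ε})` such that every graph of treewidth at least
`g(k)` contains `k` disjoint models of `H`. Then `H` has the Erdős–Pósa property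
with gap `O(g)`. -/
theorem excl_to_erdos_posa {β : Type} [Fintype β] (H : SimpleGraph β)
    (hconn : H.Connected)
    (hK5 : ¬ IsMinor (completeGraph (Fin 5)) H)
    (hK33 : ¬ IsMinor (completeBipartiteGraph (Fin 3) (Fin 3)) H)
    (ε : ℝ) (hε : 0 < ε) (g : ℕ → ℕ)
    (hg : ∃ c : ℝ, 0 < c ∧ ∃ N : ℕ, ∀ n : ℕ, N ≤ n → c * (n : ℝ) ^ (1 + ε) ≤ (g n : ℝ))
    (hmain : ∀ (α : Type) [Fintype α], ∀ (G : SimpleGraph α), ∀ k : ℕ, 0 < k →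
      g k ≤ treewidth G → HasDisjointModels H G k) :
    ∃ C : ℝ, 0 < C ∧
      ∀ (k : ℕ), 1 ≤ k →
        ∀ (α : Type) [Fintype α], ∀ (G : SimpleGraph α),
          packNumber H G ≤ k → (coverNumber H G : ℝ) ≤ C * (g k : ℝ) := by
  obtain ⟨c, hc, N, hgN⟩ := hg
  have hg1 : ∀ k, 0 < k → 1 ≤ g k := by
    intro k hk
    by_contra! h
    obtain ⟨M, hM, -⟩ := hmain Empty ⊥ k hk (by omega)
    obtain ⟨u⟩ := hconn.nonempty
    obtain ⟨a, -⟩ := ((isMinorModel_iff.1 (hM ⟨0, hk⟩)).1 u).nonempty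
    exact a.elim
  obtain ⟨C, hC, hbound⟩ := exists_superlinear_erdosPosa_bound H hconn hε (b := g 1)
    fun α _ G hG => by
      have := Fintype.ofFinite α
      by_contra! h
      exact hG (hmain α G 1 one_pos h)
  refine ⟨C / c + C * (N : ℝ) ^ (1 + ε), by positivity, fun k hk α _ G hpack => ?_⟩
  obtain ⟨S, hS, hScard⟩ := hbound k α G
    (not_hasDisjointModels_of_packNumber_le hconn.nonempty hpack)
  have hcover : (coverNumber H G : ℝ) ≤ S.ncard :=
    Nat.cast_le.2 (Nat.sInf_le ⟨S, hS, rfl⟩)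
  refine (hcover.trans hScard).trans ?_
  have hgk : (1 : ℝ) ≤ g k := by exact_mod_cast hg1 k hk
  rw [add_mul]
  rcases le_total N k with h | h
  · have h1 : C * (k : ℝ) ^ (1 + ε) ≤ C / c * g k := by
      rw [div_mul_eq_mul_div, le_div_iff₀ hc]
      calc C * (k : ℝ) ^ (1 + ε) * c = C * (c * (k : ℝ) ^ (1 + ε)) := by ring
        _ ≤ C * g k := by gcongr; exact hgN k h
    have h2 : 0 ≤ C * (N : ℝ) ^ (1 + ε) * g k := by positivity
    linarith
  · have h1 : C * (k : ℝ) ^ (1 + ε) ≤ C * (N : ℝ) ^ (1 + ε) * 1 := by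
      rw [mul_one]
      gcongr
    have h2 : C * (N : ℝ) ^ (1 + ε) * 1 ≤ C * (N : ℝ) ^ (1 + ε) * g k := by gcongr
    have h3 : 0 ≤ C / c * g k := by positivity
    linarith
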